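/- arXiv:2310.10809 — 2 statements merged into one kernel-verified Lean document; each statement's English description precedes it below -/
import Mathlib

section
/- For each k ∈ {1,…,m} define p_k := E_{π_entrance}[(R(0) − R(σ_1)) v_k^{−1} 1_{l(0)=k}] / E_{π_entrance}[(R(0) − R(σ_1)) v_{l(0)}^{−1}]. Then the following three expressions coincide: p_k = (E_{π_entrance}[R(0) v_k^{−1} 1_{l(0)=k}] − E_{π_exit}[R(0) v_k^{−1} 1_{l(0)=k}]) / (E_{π_entrance}[R(0) v_{l(0)}^{−1}] − E_{π_exit}[R(0) v_{l(0)}^{−1}]) = E_{π_exit}[R(1) v_{l(1)}^{−1} 1_{l(1)=k} − R(0) v_{l(0)}^{−1} 1_{l(0)=k}] / E_{π_exit}[R(1) v_{l(1)}^{−1} − R(0) v_{l(0)}^{−1}]; moreover p_k > 0 for every k and p_1 + ⋯ + p_m = 1. -/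
open MeasureTheory Filter
open scoped ENNReal

/-- `sigmaT ι ω = σ_{ι+1}(ω)`: the `(ι+1)`-st exit time of the radius from `ℕ`
along a trajectory `ω` in `ℤ × {1,…,m}`, i.e. `σ₁ = inf {k ≥ 0 : R(k) ≤ 0}`
and `σ_{ι+1} = inf {k > σ_ι : R(k) ≤ 0}`. -/
noncomputable def sigmaT {m : ℕ} : ℕ → (ℕ → ℤ × Fin m) → ℕ
  | 0, ω => sInf {k : ℕ | (ω k).1 ≤ 0}
  | ι + 1, ω => sInf {k : ℕ | sigmaT ι ω < k ∧ (ω k).1 ≤ 0}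

/-- The `n`-step transition probabilities of the kernel `K`. -/
noncomputable def iterK {m : ℕ} (K : ℤ × Fin m → PMF (ℤ × Fin m)) :
    ℕ → ℤ × Fin m → PMF (ℤ × Fin m)
  | 0, s => PMF.pure s
  | n + 1, s => (iterK K n s).bind K

/-- `π` is a stationary distribution of the embedded exit chain
`𝒳_exit(ι) = 𝒳(σ_ι)`: a probability distribution on the state space
`{…,−1,0} × {1,…,m}` of that chain which is invariant under its transition
kernel (from an exit state `s` the next exit value is `ω(σ₂)` under `P s`). -/
def ExitStationary {m : ℕ} (P : ℤ × Fin m → Measure (ℕ → ℤ × Fin m))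
    (π : Measure (ℤ × Fin m)) : Prop :=
  IsProbabilityMeasure π ∧ π {s : ℤ × Fin m | 1 ≤ s.1} = 0 ∧
  ∀ A : Set (ℤ × Fin m),
    ∑' s : ℤ × Fin m, π {s} * P s {ω | ω (sigmaT 1 ω) ∈ A} = π A

/-- `π` is a stationary distribution of the embedded entrance chain
`𝒳_entrance(ι) = 𝒳(τ_ι) = 𝒳(σ_ι + 1)`: a probability distribution on the
state space `ℕ × {1,…,m}` of that chain which is invariant under its
transition kernel (from an entrance state `s` the next entrance value is
`ω(σ₁ + 1)` under `P s`). -/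
def EntranceStationary {m : ℕ} (P : ℤ × Fin m → Measure (ℕ → ℤ × Fin m))
    (π : Measure (ℤ × Fin m)) : Prop :=
  IsProbabilityMeasure π ∧ π {s : ℤ × Fin m | s.1 ≤ 0} = 0 ∧
  ∀ A : Set (ℤ × Fin m),
    ∑' s : ℤ × Fin m, π {s} * P s {ω | ω (sigmaT 0 ω + 1) ∈ A} = π A

/-- concave function with slopes `d` -/
noncomputable def cphi (d : ℕ → ℝ) (x : ℤ) : ℝ :=
  ∑ j ∈ Finset.range x.toNat, d j + d 0 * ((min x 0 : ℤ) : ℝ)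

lemma cphi_step (d : ℕ → ℝ) (x : ℤ) : cphi d (x + 1) = cphi d x + d x.toNat := by
  unfold cphi
  rcases le_or_gt 0 x with h | h
  · have h1 : (x + 1).toNat = x.toNat + 1 := by omega
    rw [h1, Finset.sum_range_succ, min_eq_right h, min_eq_right (by omega)]
    ring
  · have h1 : (x + 1).toNat = 0 := by omega
    have h2 : x.toNat = 0 := by omega
    rw [h1, h2, min_eq_left h.le, min_eq_left (by omega)]
    push_cast; simp; ring

lemma cphi_up (d : ℕ → ℝ) (hd : Antitone d) (x : ℤ) (n : ℕ) :
    cphi d (x + n) ≤ cphi d x + n * d x.toNat := by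
  induction n with
  | zero => simp
  | succ n ih =>
    have := cphi_step d (x + n)
    have h2 : d (x + n).toNat ≤ d x.toNat := hd (by omega)
    push_cast
    rw [← add_assoc, this]
    linarith

lemma cphi_down (d : ℕ → ℝ) (hd : Antitone d) (x : ℤ) (n : ℕ) :
    cphi d (x - n) ≤ cphi d x - n * d (x - 1).toNat := by
  induction n with
  | zero => simp
  | succ n ih =>
    have := cphi_step d (x - n - 1)
    have h2 : d (x - 1).toNat ≤ d (x - n - 1).toNat := hd (by omega)
    rw [show x - (n : ℤ) - 1 + 1 = x - n by ring] at this
    push_cast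
    rw [show x - ((n : ℤ) + 1) = x - n - 1 by ring]
    linarith

lemma cphi_tangent (d : ℕ → ℝ) (hd : Antitone d) (x y : ℤ) :
    cphi d (x + y) ≤ cphi d x + (max (y : ℝ) 0) * d x.toNat - (max (-y : ℝ) 0) * d (x - 1).toNat := by
  obtain ⟨n, rfl | rfl⟩ := y.eq_nat_or_neg
  · have := cphi_up d hd x n
    simpa using this
  · have := cphi_down d hd x n
    simpa [← sub_eq_add_neg] using this

lemma cphi_nonpos (d : ℕ → ℝ) (x : ℤ) (hx : x ≤ 0) : cphi d x = d 0 * x := by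
  unfold cphi
  rw [show x.toNat = 0 by omega, min_eq_left hx]; simp

lemma cphi_le (d : ℕ → ℝ) (hd : Antitone d) (x : ℤ) (hx : 0 ≤ x) : cphi d x ≤ d 0 * x := by
  have := cphi_up d hd 0 x.toNat
  have h0 := cphi_nonpos d 0 le_rfl
  have h2 : ((x.toNat : ℤ)) = x := by omega
  have h3 : ((x.toNat : ℝ)) = x := by exact_mod_cast h2
  rw [h2, h3, h0] at this
  simp at this
  linarith

lemma cphi_ge (d : ℕ → ℝ) (e : ℝ) (hd : ∀ n, e ≤ d n) (x : ℤ) (hx : 0 ≤ x) : e * x ≤ cphi d x := by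
  unfold cphi
  have h2 : ((x.toNat : ℤ)) = x := by omega
  have h3 : ((x.toNat : ℝ)) = x := by exact_mod_cast h2
  rw [min_eq_right hx]
  have : ∑ j ∈ Finset.range x.toNat, e ≤ ∑ j ∈ Finset.range x.toNat, d j :=
    Finset.sum_le_sum fun i _ => hd i
  simp [h3] at this
  simp; linarith

lemma neg_part_sum (y : ℤ) (N : ℕ) :
    ∑ n ∈ Finset.range N, max (-((y : ℝ) + n)) 0 ≤ (y : ℝ) ^ 2 := by
  have key : ∀ N : ℕ, ∑ n ∈ Finset.range N, max (-(y + n)) 0 ≤ y ^ 2 - (max (-(y + N)) 0) ^ 2 := by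
    intro N
    induction N with
    | zero =>
      simp
      rcases le_total (-y) 0 with h | h
      · rw [max_eq_right h]; positivity
      · rw [max_eq_left h]; simp
    | succ n ih =>
      rw [Finset.sum_range_succ]
      push_cast
      rcases le_or_gt (-(y + n)) 0 with h | h
      · rw [max_eq_right h] at ih ⊢
        rw [max_eq_right (by omega)]; linarith
      · rw [max_eq_left h.le] at ih ⊢
        rw [max_eq_left (by omega)]
        nlinarith
  have h := (key N).trans (sub_le_self _ (sq_nonneg _))
  have : ((∑ n ∈ Finset.range N, max (-(y + n)) 0 : ℤ) : ℝ) ≤ ((y ^ 2 : ℤ) : ℝ) := by exact_mod_cast h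
  push_cast at this
  exact this

lemma lyap (w : ℤ → ℝ) (hw : ∀ y, 0 ≤ w y) (hw1 : HasSum w 1)
    (hint : Summable fun y : ℤ => |(y : ℝ)| * w y)
    (hmean : ∑' y : ℤ, (y : ℝ) * w y = 0)
    (hsq : Summable fun y : ℤ => (y : ℝ) ^ 2 * w y)
    (hvar : 0 < ∑' y : ℤ, (y : ℝ) ^ 2 * w y) (ε : ℝ) (hε : 0 < ε) :
    ∃ (f : ℤ → ℝ) (B δ : ℝ), 0 < δ ∧ 0 ≤ B ∧ (∀ x, 0 ≤ f x) ∧ (∀ x : ℤ, x ≤ 0 → |(x : ℝ)| ≤ f x) ∧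
      (∀ x : ℤ, 1 ≤ x → δ * x ≤ f x) ∧ (∀ x : ℤ, 1 ≤ x → f x ≤ ε * x + B) ∧
      (∀ x, Summable fun y => w y * f (x + y)) ∧
      (∀ x, 1 ≤ x → ∑' y, w y * f (x + y) < f x) := by
  -- positive and negative parts
  have hsum : ∀ (g : ℤ → ℝ) (c : ℝ), (∀ y, |g y| ≤ c * (1 + |(y : ℝ)|)) → Summable fun y => w y * g y := by
    intro g c hg
    refine Summable.of_norm_bounded (g := fun y => c * (w y + |(y : ℝ)| * w y)) ((hw1.summable.add hint).mul_left c) ?_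
    intro y
    rw [Real.norm_eq_abs, abs_mul, abs_of_nonneg (hw y)]
    have := mul_le_mul_of_nonneg_left (hg y) (hw y)
    linarith
  have hs_y : Summable fun y : ℤ => w y * (y : ℝ) := hsum _ 1 fun y => by linarith [abs_nonneg (y : ℝ)]
  have hs_p : Summable fun y : ℤ => w y * max (y : ℝ) 0 := hsum _ 1 fun y => by
    rw [abs_of_nonneg (le_max_right _ _)]
    exact max_le (by linarith [le_abs_self (y : ℝ)]) (by positivity)
  have hs_m : Summable fun y : ℤ => w y * max (-y : ℝ) 0 := hsum _ 1 fun y => by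
    rw [abs_of_nonneg (le_max_right _ _)]
    exact max_le (by linarith [neg_abs_le (y : ℝ)]) (by positivity)
  obtain ⟨a, ha⟩ : ∃ a, a = ∑' y : ℤ, w y * max (y : ℝ) 0 := ⟨_, rfl⟩
  have ham : ∑' y : ℤ, w y * max (-y : ℝ) 0 = a := by
    have : ∑' y : ℤ, (w y * max (y : ℝ) 0 - w y * max (-y : ℝ) 0) = 0 := by
      refine Eq.trans ?_ hmean
      refine tsum_congr fun y => ?_
      rcases le_total (0 : ℝ) y with h | h
      · rw [max_eq_left h, max_eq_right (by linarith)]; ring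
      · rw [max_eq_right h, max_eq_left (by linarith)]; ring
    rw [hs_p.tsum_sub hs_m] at this
    linarith
  have hp0 : ∀ y : ℤ, 0 ≤ w y * max (y : ℝ) 0 := fun y => mul_nonneg (hw y) (le_max_right _ _)
  have hm0 : ∀ y : ℤ, 0 ≤ w y * max (-y : ℝ) 0 := fun y => mul_nonneg (hw y) (le_max_right _ _)
  have hapos : 0 < a := by
    have h0 : 0 ≤ a := ha ▸ tsum_nonneg hp0
    rcases h0.lt_or_eq with h | h
    · exact h
    · exfalso
      have e1 := (hasSum_zero_iff_of_nonneg hp0).1 (by have := hs_p.hasSum; rwa [← ha, ← h] at this)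
      have e2 := (hasSum_zero_iff_of_nonneg hm0).1 (by have := hs_m.hasSum; rwa [ham, ← h] at this)
      have : ∀ y : ℤ, (y : ℝ) ^ 2 * w y = 0 := by
        intro y
        have h1 := congrFun e1 y
        have h2 := congrFun e2 y
        simp only [Pi.zero_apply] at h1 h2
        rcases le_total (0 : ℝ) y with h | h
        · rw [max_eq_left h] at h1
          rw [pow_two, mul_assoc, mul_comm (y : ℝ) (w y), h1, mul_zero]
        · rw [max_eq_left (by linarith)] at h2
          have : w y * (y : ℝ) = 0 := by linarith
          rw [pow_two, mul_assoc, mul_comm (y : ℝ) (w y), this, mul_zero]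
      simp [this] at hvar
  -- r
  obtain ⟨r, hr⟩ : ∃ r : ℕ → ℝ, ∀ n, r n = ∑' y : ℤ, w y * max (-((y : ℝ) + n)) 0 := ⟨_, fun _ => rfl⟩
  have hs_r : ∀ n : ℕ, Summable fun y : ℤ => w y * max (-((y : ℝ) + n)) 0 := fun n =>
    hsum _ 1 fun y => by
      rw [abs_of_nonneg (le_max_right _ _)]
      exact max_le (by linarith [neg_abs_le (y : ℝ), (Nat.cast_nonneg n : (0 : ℝ) ≤ n)]) (by positivity)
  have hr0 : ∀ n, 0 ≤ r n := fun n => by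
    rw [hr]; exact tsum_nonneg fun y => mul_nonneg (hw y) (le_max_right _ _)
  have hrs : Summable r := by
    refine summable_of_sum_range_le (c := ∑' y : ℤ, (y : ℝ) ^ 2 * w y) hr0 fun N => ?_
    simp_rw [hr]
    rw [← Summable.tsum_finsetSum (fun i _ => hs_r i)]
    refine Summable.tsum_le_tsum (fun y => ?_) (summable_sum fun i _ => hs_r i) hsq
    rw [← Finset.mul_sum, mul_comm]
    exact mul_le_mul_of_nonneg_right (neg_part_sum y N) (hw y)
  obtain ⟨ρ, hρ⟩ : ∃ ρ : ℕ → ℝ, ∀ n, ρ n = r (n + 1) / a + (1 / 2 : ℝ) ^ n := ⟨_, fun _ => rfl⟩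
  have hρ0 : ∀ n, 0 < ρ n := fun n => by
    rw [hρ]; have := div_nonneg (hr0 (n + 1)) hapos.le; positivity
  have hρs : Summable ρ := by
    have : ρ = fun n => r (n + 1) / a + (1 / 2 : ℝ) ^ n := funext hρ
    rw [this]
    exact (((summable_nat_add_iff 1).2 hrs).div_const a).add summable_geometric_two
  obtain ⟨T, hT⟩ : ∃ T : ℕ → ℝ, ∀ n, T n = ∑' j, ρ (j + n) := ⟨_, fun _ => rfl⟩
  have hTstep : ∀ n, T n = ρ n + T (n + 1) := fun n => by
    rw [hT, hT, ((summable_nat_add_iff n).2 hρs).tsum_eq_zero_add]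
    simp only [zero_add]
    refine congrArg _ (tsum_congr fun j => ?_)
    rw [show j + 1 + n = j + (n + 1) by ring]
  have hT0 : ∀ n, 0 ≤ T n := fun n => by rw [hT]; exact tsum_nonneg fun j => (hρ0 _).le
  have hTanti : Antitone T := antitone_nat_of_succ_le fun n => by linarith [hTstep n, hρ0 n]
  obtain ⟨e, he⟩ : ∃ e : ℝ, e = min (ε / 4) (1 / 4) := ⟨_, rfl⟩
  have he0 : 0 < e := by rw [he]; positivity
  have he1 : e ≤ ε / 4 := he ▸ min_le_left _ _
  have he2 : e ≤ 1 / 4 := he ▸ min_le_right _ _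
  obtain ⟨L, hL⟩ : ∃ L, T L < e := by
    have : Tendsto T atTop (nhds 0) := by
      have := tendsto_sum_nat_add ρ
      refine this.congr fun n => (hT n).symm
    exact ((this.eventually (gt_mem_nhds he0)).exists)
  obtain ⟨d, hd⟩ : ∃ d : ℕ → ℝ, ∀ n, d n = e + T (n + L) := ⟨_, fun _ => rfl⟩
  have hdanti : Antitone d := fun i j hij => by
    rw [hd, hd]; linarith [hTanti (show i + L ≤ j + L by omega)]
  have hde : ∀ n, e ≤ d n := fun n => by rw [hd]; linarith [hT0 (n + L)]
  have hd0 : d 0 ≤ 2 * e := by rw [hd, zero_add]; linarith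
  have hd0' : 0 < d 0 := he0.trans_le (hde 0)
  have hφabs : ∀ x : ℤ, |cphi d x| ≤ d 0 * |(x : ℝ)| := by
    intro x
    rcases le_total x 0 with h | h
    · rw [cphi_nonpos d x h, abs_mul, abs_of_pos hd0']
    · have hx : (0 : ℝ) ≤ x := by exact_mod_cast h
      rw [abs_of_nonneg ((mul_nonneg he0.le hx).trans (cphi_ge d e hde x h)), abs_of_nonneg hx]
      exact cphi_le d hdanti x h
  obtain ⟨g, hg⟩ : ∃ g : ℤ → ℝ, ∀ x, g x = max (-((x : ℝ) + L)) 0 + cphi d x := ⟨_, fun _ => rfl⟩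
  have hL0 : (0 : ℝ) ≤ L := Nat.cast_nonneg L
  have hgneg : ∀ x : ℤ, x ≤ 0 → |(x : ℝ)| ≤ 2 * (g x + L) := by
    intro x hx
    have hx' : (x : ℝ) ≤ 0 := by exact_mod_cast hx
    rw [hg, cphi_nonpos d x hx, abs_of_nonpos hx']
    have := le_max_left (-((x : ℝ) + L)) 0
    nlinarith
  have hgpos : ∀ x : ℤ, 0 ≤ x → g x = cphi d x := by
    intro x hx
    have hx' : (0 : ℝ) ≤ x := by exact_mod_cast hx
    rw [hg, max_eq_right (by linarith), zero_add]
  have hgs : ∀ x : ℤ, Summable fun y => w y * g (x + y) := by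
    intro x
    refine hsum _ ((1 + d 0) * (1 + |(x : ℝ)|)) fun y => ?_
    have h1 := hφabs (x + y)
    have h2 : |g (x + y)| ≤ (1 + d 0) * |((x + y : ℤ) : ℝ)| := by
      rw [hg]
      refine (abs_add_le _ _).trans ?_
      rw [abs_of_nonneg (le_max_right (-(((x + y : ℤ) : ℝ) + L)) 0)]
      have : max (-(((x + y : ℤ) : ℝ) + L)) 0 ≤ |((x + y : ℤ) : ℝ)| :=
        max_le (by linarith [neg_abs_le ((x + y : ℤ) : ℝ)]) (abs_nonneg _)
      linarith
    refine h2.trans ?_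
    rw [mul_assoc]
    refine mul_le_mul_of_nonneg_left ?_ (by linarith)
    push_cast
    have := abs_add_le (x : ℝ) y
    nlinarith [abs_nonneg (x : ℝ), abs_nonneg (y : ℝ), mul_nonneg (abs_nonneg (x : ℝ)) (abs_nonneg (y : ℝ))]
  have hgsuper : ∀ x : ℤ, 1 ≤ x → ∑' y, w y * g (x + y) < g x := by
    intro x hx
    obtain ⟨n, rfl⟩ : ∃ n : ℕ, x = n + 1 := ⟨(x - 1).toNat, by omega⟩
    have hb : ∀ y : ℤ, w y * g ((n + 1 : ℤ) + y) ≤ w y * max (-((y : ℝ) + (n + 1 + L : ℕ))) 0 +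
        (w y * cphi d (n + 1) + w y * max (y : ℝ) 0 * d (n + 1) - w y * max (-y : ℝ) 0 * d n) := by
      intro y
      have h := cphi_tangent d hdanti (n + 1) y
      rw [show ((n : ℤ) + 1).toNat = n + 1 by omega, show ((n : ℤ) + 1 - 1).toNat = n by omega] at h
      have := mul_le_mul_of_nonneg_left h (hw y)
      rw [hg]
      push_cast
      rw [show -((n : ℝ) + 1 + y + L) = -((y : ℝ) + (n + 1 + L)) by ring]
      linarith
    have hs := (((hw1.summable.mul_right (cphi d (n + 1))).add (hs_p.mul_right (d (n + 1)))).sub (hs_m.mul_right (d n)))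
    have := Summable.tsum_le_tsum hb (hgs _) ((hs_r (n + 1 + L)).add hs)
    rw [(hs_r (n + 1 + L)).tsum_add hs, Summable.tsum_sub ((hw1.summable.mul_right (cphi d (n + 1))).add (hs_p.mul_right (d (n + 1)))) (hs_m.mul_right (d n)),
      Summable.tsum_add (hw1.summable.mul_right (cphi d (n + 1))) (hs_p.mul_right (d (n + 1))), tsum_mul_right, tsum_mul_right, tsum_mul_right,
      hw1.tsum_eq, ham, ← ha, ← hr] at this
    rw [hgpos _ (by omega)]
    have hstep : d n = d (n + 1) + ρ (n + L) := by
      rw [hd, hd, hTstep (n + L)]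
      rw [show n + 1 + L = n + L + 1 by ring]; ring
    have h3 : a * ρ (n + L) = r (n + 1 + L) + a * (1 / 2) ^ (n + L) := by
      rw [hρ, show n + 1 + L = n + L + 1 by ring]
      field_simp
    have hpos : 0 < a * (1 / 2 : ℝ) ^ (n + L) := by positivity
    rw [hstep] at this
    linarith
  refine ⟨fun x => 2 * (g x + L), 2 * L, 2 * e, by positivity, by positivity, ?_, hgneg, ?_, ?_, ?_, ?_⟩
  · intro x
    rcases le_total x 0 with h | h
    · exact (abs_nonneg _).trans (hgneg x h)
    · have hx : (0 : ℝ) ≤ x := by exact_mod_cast h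
      have := cphi_ge d e hde x h
      have := hgpos x h
      have := mul_nonneg he0.le hx
      simp only; linarith
  · intro x hx
    have hx' : (0 : ℝ) ≤ x := by exact_mod_cast (by omega : 0 ≤ x)
    have := cphi_ge d e hde x (by omega)
    simp only
    rw [hgpos x (by omega)]; linarith
  · intro x hx
    have hx' : (0 : ℝ) ≤ x := by exact_mod_cast (by omega : 0 ≤ x)
    have := cphi_le d hdanti x (by omega)
    simp only
    rw [hgpos x (by omega)]; nlinarith
  · intro x
    have := ((hgs x).add (hw1.summable.mul_right (L : ℝ))).mul_left 2
    refine this.congr fun y => ?_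
    ring
  · intro x hx
    have h1 : ∀ y, w y * (2 * (g (x + y) + L)) = 2 * (w y * g (x + y) + w y * L) := fun y => by ring
    simp_rw [h1]
    rw [tsum_mul_left, (hgs x).tsum_add (hw1.summable.mul_right (L : ℝ)), tsum_mul_right, hw1.tsum_eq]
    linarith [hgsuper x hx]

lemma max_principle (w : ℤ → ℝ) (hw : ∀ y, 0 ≤ w y) (hw1 : HasSum w 1)
    (f : ℤ → ℝ) (δ : ℝ) (hδ : 0 < δ) (hf0 : ∀ x, 0 ≤ f x) (hf : ∀ x : ℤ, 1 ≤ x → δ * x ≤ f x)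
    (hfs : ∀ x, Summable fun y => w y * f (x + y))
    (hfsup : ∀ x, 1 ≤ x → ∑' y, w y * f (x + y) < f x)
    (q : ℤ → ℝ) (hq0 : ∀ x, 0 ≤ q x) (hq1 : ∀ x, q x ≤ 1) (hqn : ∀ x ≤ 0, q x = 0)
    (hqh : ∀ x, 1 ≤ x → q x = ∑' y, w y * q (x + y)) : ∀ x, q x = 0 := by
  have hqs : ∀ x, Summable fun y => w y * q (x + y) := fun x =>
    Summable.of_nonneg_of_le (fun y => mul_nonneg (hw y) (hq0 _))
      (fun y => mul_le_of_le_one_right (hw y) (hq1 _)) hw1.summable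
  have key : ∀ c : ℝ, 0 < c → ∀ x, q x ≤ c * f x := by
    intro c hc
    by_contra! hcon
    obtain ⟨x0, hx0⟩ := hcon
    obtain ⟨N, hN⟩ := exists_nat_gt (1 / (c * δ))
    have hbig : ∀ x : ℤ, 0 < q x - c * f x → x ∈ Finset.Icc (1 : ℤ) N := by
      intro x hx
      have hx1 : 1 ≤ x := by
        by_contra h
        rw [hqn x (by omega)] at hx
        nlinarith [hf0 x, mul_nonneg hc.le (hf0 x)]
      rw [Finset.mem_Icc]
      refine ⟨hx1, ?_⟩
      by_contra h
      have h' : (N : ℝ) < x := by exact_mod_cast (not_le.1 h)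
      have h2 := hf x hx1
      have h3 := hq1 x
      have h4 : 1 / (c * δ) < x := hN.trans h'
      rw [div_lt_iff₀ (by positivity)] at h4
      nlinarith
    have hx0' := hbig x0 (by linarith)
    obtain ⟨x1, hx1, hmax⟩ := Finset.exists_max_image (Finset.Icc (1 : ℤ) N) (fun x => q x - c * f x) ⟨x0, hx0'⟩
    have hMpos : 0 < q x1 - c * f x1 := by have := hmax x0 hx0'; linarith
    have hall : ∀ x, q x - c * f x ≤ q x1 - c * f x1 := by
      intro x
      by_cases hx : 0 < q x - c * f x
      · exact hmax x (hbig x hx)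
      · linarith
    have h1 : 1 ≤ x1 := (Finset.mem_Icc.1 hx1).1
    have hs := (hqs x1).sub ((hfs x1).mul_left c)
    have hle : ∑' y, (w y * q (x1 + y) - c * (w y * f (x1 + y))) ≤ ∑' y, w y * (q x1 - c * f x1) := by
      refine Summable.tsum_le_tsum (fun y => ?_) hs (hw1.summable.mul_right _)
      have := mul_le_mul_of_nonneg_left (hall (x1 + y)) (hw y)
      linarith
    rw [(hqs x1).tsum_sub ((hfs x1).mul_left c), tsum_mul_left, tsum_mul_right, hw1.tsum_eq, ← hqh x1 h1] at hle
    have := mul_lt_mul_of_pos_left (hfsup x1 h1) hc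
    linarith
  intro x
  refine le_antisymm ?_ (hq0 x)
  refine le_of_forall_pos_le_add fun e he => ?_
  have := key (e / (f x + 1)) (div_pos he (by linarith [hf0 x])) x
  have h2 : e / (f x + 1) * f x ≤ e := by
    rw [div_mul_eq_mul_div, div_le_iff₀ (by linarith [hf0 x])]
    nlinarith [hf0 x]
  linarith

/-- one-step operator -/
noncomputable def KF {m : ℕ} (K : ℤ × Fin m → PMF (ℤ × Fin m)) (F : ℤ × Fin m → ℝ≥0∞)
    (s : ℤ × Fin m) : ℝ≥0∞ := ∑' u, K s u * F u

/-- expectation of `F` at the exit, on exiting exactly at time `n` -/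
noncomputable def hop {m : ℕ} (K : ℤ × Fin m → PMF (ℤ × Fin m)) (F : ℤ × Fin m → ℝ≥0∞) :
    ℕ → ℤ × Fin m → ℝ≥0∞
  | 0, s => if s.1 ≤ 0 then F s else 0
  | n + 1, s => if s.1 ≤ 0 then 0 else KF K (hop K F n) s

/-- expectation of `F` at the exit -/
noncomputable def HF {m : ℕ} (K : ℤ × Fin m → PMF (ℤ × Fin m)) (F : ℤ × Fin m → ℝ≥0∞)
    (s : ℤ × Fin m) : ℝ≥0∞ := ∑' n, hop K F n s

section kernel
variable {m : ℕ} (K : ℤ × Fin m → PMF (ℤ × Fin m))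

lemma KF_mono {F G : ℤ × Fin m → ℝ≥0∞} (h : ∀ s, F s ≤ G s) (s) : KF K F s ≤ KF K G s :=
  ENNReal.tsum_le_tsum fun u => by gcongr; exact h u

lemma KF_tsum {ι : Type*} (c : ι → ℝ≥0∞) (F : ι → ℤ × Fin m → ℝ≥0∞) (s) :
    KF K (fun t => ∑' i, c i * F i t) s = ∑' i, c i * KF K (F i) s := by
  unfold KF
  simp_rw [← ENNReal.tsum_mul_left]
  rw [ENNReal.tsum_comm]
  refine tsum_congr fun i => tsum_congr fun u => ?_
  ring

lemma KF_tsum' {ι : Type*} (F : ι → ℤ × Fin m → ℝ≥0∞) (s) :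
    KF K (fun t => ∑' i, F i t) s = ∑' i, KF K (F i) s := by
  have := KF_tsum K (fun _ : ι => 1) F s
  simpa using this

lemma KF_one (s) : KF K (fun _ => 1) s = 1 := by
  unfold KF; simp [(K s).tsum_coe]

lemma hop_tsum {ι : Type*} (c : ι → ℝ≥0∞) (F : ι → ℤ × Fin m → ℝ≥0∞) (n : ℕ) :
    ∀ s, hop K (fun t => ∑' i, c i * F i t) n s = ∑' i, c i * hop K (F i) n s := by
  induction n with
  | zero => intro s; simp only [hop]; split_ifs <;> simp
  | succ n ih =>
    intro s
    simp only [hop]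
    split_ifs
    · simp
    · rw [← KF_tsum]
      congr 1
      funext t; exact ih t

lemma HF_tsum {ι : Type*} (c : ι → ℝ≥0∞) (F : ι → ℤ × Fin m → ℝ≥0∞) (s) :
    HF K (fun t => ∑' i, c i * F i t) s = ∑' i, c i * HF K (F i) s := by
  unfold HF
  simp_rw [hop_tsum, ← ENNReal.tsum_mul_left]
  rw [ENNReal.tsum_comm]

lemma hop_mono {F G : ℤ × Fin m → ℝ≥0∞} (h : ∀ s : ℤ × Fin m, s.1 ≤ 0 → F s ≤ G s) (n : ℕ) :
    ∀ s, hop K F n s ≤ hop K G n s := by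
  induction n with
  | zero => intro s; simp only [hop]; split_ifs with h0; exacts [h s h0, le_rfl]
  | succ n ih =>
    intro s
    simp only [hop]
    split_ifs
    · exact le_rfl
    · exact KF_mono K ih s

lemma HF_mono {F G : ℤ × Fin m → ℝ≥0∞} (h : ∀ s : ℤ × Fin m, s.1 ≤ 0 → F s ≤ G s) (s) :
    HF K F s ≤ HF K G s := ENNReal.tsum_le_tsum fun n => hop_mono K h n s

lemma HF_congr {F G : ℤ × Fin m → ℝ≥0∞} (h : ∀ s : ℤ × Fin m, s.1 ≤ 0 → F s = G s) (s) :
    HF K F s = HF K G s :=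
  le_antisymm (HF_mono K (fun s hs => (h s hs).le) s) (HF_mono K (fun s hs => (h s hs).ge) s)

lemma HF_nonpos (F : ℤ × Fin m → ℝ≥0∞) (s : ℤ × Fin m) (hs : s.1 ≤ 0) : HF K F s = F s := by
  unfold HF
  rw [tsum_eq_single 0]
  · simp [hop, hs]
  · intro n hn
    obtain ⟨k, rfl⟩ := Nat.exists_eq_succ_of_ne_zero hn
    simp [hop, hs]

lemma HF_pos (F : ℤ × Fin m → ℝ≥0∞) (s : ℤ × Fin m) (hs : 1 ≤ s.1) :
    HF K F s = KF K (HF K F) s := by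
  have hs' : ¬ s.1 ≤ 0 := by omega
  have : HF K F = fun t => ∑' n, hop K F n t := rfl
  rw [this, KF_tsum']
  simp only
  rw [tsum_eq_zero_add' ENNReal.summable]
  simp [hop, hs']

/-- Minimality. -/
lemma HF_le (F V : ℤ × Fin m → ℝ≥0∞) (hFV : ∀ s : ℤ × Fin m, s.1 ≤ 0 → F s ≤ V s)
    (hV : ∀ s : ℤ × Fin m, 1 ≤ s.1 → KF K V s ≤ V s) (s) : HF K F s ≤ V s := by
  have key : ∀ n, ∀ s, ∑ j ∈ Finset.range n, hop K F j s ≤ V s := by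
    intro n
    induction n with
    | zero => intro s; simp
    | succ n ih =>
      intro s
      rw [Finset.sum_range_succ']
      by_cases h : s.1 ≤ 0
      · simp [hop, h, hFV s h]
      · simp only [hop, h, if_false, add_zero]
        refine le_trans ?_ (hV s (by omega))
        refine le_trans (le_of_eq ?_) (KF_mono K ih s)
        unfold KF
        simp_rw [Finset.mul_sum]
        rw [Summable.tsum_finsetSum (fun _ _ => ENNReal.summable)]
  unfold HF
  rw [ENNReal.tsum_eq_iSup_nat]
  exact iSup_le fun n => key n s

lemma HF_zero_of (F : ℤ × Fin m → ℝ≥0∞) (Z : Set (ℤ × Fin m))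
    (hZ : ∀ s ∈ Z, 1 ≤ s.1 → ∀ u, K s u ≠ 0 → u ∈ Z) (hF : ∀ s ∈ Z, s.1 ≤ 0 → F s = 0) :
    ∀ s ∈ Z, HF K F s = 0 := by
  classical
  intro s hs
  have := HF_le K F (fun s => if s ∈ Z then 0 else ⊤) (fun s hs => by
    by_cases h : s ∈ Z
    · simp [h, hF s h hs]
    · simp [h]) (fun s hs => by
    by_cases h : s ∈ Z
    · simp only [h, if_true, nonpos_iff_eq_zero]
      unfold KF
      rw [ENNReal.tsum_eq_zero]
      intro u
      by_cases hu : K s u = 0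
      · simp [hu]
      · simp [hZ s h hs u hu]
    · simp [h]) s
  simpa [hs] using this

end kernel

/-- Uniqueness of invariant distributions. -/
lemma invDist_unique {S : Type*} (Q : S → S → ℝ≥0∞) (hQ : ∀ s, ∑' t, Q s t ≤ 1)
    (a b : S → ℝ≥0∞) (ha1 : ∑' s, a s = 1) (hb1 : ∑' s, b s = 1)
    (ha : ∀ t, ∑' s, a s * Q s t = a t) (hb : ∀ t, ∑' s, b s * Q s t = b t)
    (hacc : ∀ μ : S → ℝ≥0∞, (∀ s, μ s ≤ a s) → (∀ t, ∑' s, μ s * Q s t = μ t) → ∀ s t, μ s ≠ 0 → b t ≠ 0 → μ t ≠ 0) :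
    a = b := by
  have hsq : ∀ (x y : S → ℝ≥0∞), (∀ s, x s ≤ y s) → ∑' s, x s = 1 → ∑' s, y s = 1 → x = y := by
    intro x y hxy hx hy
    funext s
    refine le_antisymm (hxy s) ?_
    by_contra h
    have := ENNReal.tsum_lt_tsum (f := x) (g := y) (by simp [hx]) hxy (not_le.1 h)
    rw [hx, hy] at this
    exact lt_irrefl _ this
  obtain ⟨ν, hν⟩ : ∃ ν : S → ℝ≥0∞, ∀ s, ν s = min (a s) (b s) := ⟨_, fun _ => rfl⟩
  have hνa : ∀ s, ν s ≤ a s := fun s => by rw [hν]; exact min_le_left _ _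
  have hνb : ∀ s, ν s ≤ b s := fun s => by rw [hν]; exact min_le_right _ _
  have hνfin : ∑' s, ν s ≠ ⊤ := by
    have : ∑' s, ν s ≤ 1 := ha1 ▸ ENNReal.tsum_le_tsum hνa
    exact ne_top_of_le_ne_top (by simp) this
  have hafin : ∀ s, a s ≠ ⊤ := fun s => ENNReal.ne_top_of_tsum_ne_top (by simp [ha1]) s
  -- total mass of Q on support is full
  have hα1 : ∀ s, a s - ν s + ν s = a s := fun s => tsub_add_cancel_of_le (hνa s)
  have hνQle : ∀ t, ∑' s, ν s * Q s t ≤ ν t := by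
    intro t
    conv_rhs => rw [hν]
    refine le_min ?_ ?_
    · rw [← ha t]; exact ENNReal.tsum_le_tsum fun s => by gcongr; exact hνa s
    · rw [← hb t]; exact ENNReal.tsum_le_tsum fun s => by gcongr; exact hνb s
  -- α Q total ≤ α total
  have hmassle : ∀ x : S → ℝ≥0∞, ∑' t, ∑' s, x s * Q s t ≤ ∑' s, x s := by
    intro x
    rw [ENNReal.tsum_comm]
    refine ENNReal.tsum_le_tsum fun s => ?_
    rw [ENNReal.tsum_mul_left]
    exact mul_le_of_le_one_right' (hQ s)
  have hmass : ∑' t, ∑' s, ν s * Q s t = ∑' s, ν s := by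
    refine le_antisymm (hmassle ν) ?_
    have h1 : ∑' t, ∑' s, a s * Q s t = ∑' t, ∑' s, (a s - ν s) * Q s t + ∑' t, ∑' s, ν s * Q s t := by
      rw [← ENNReal.tsum_add]
      refine tsum_congr fun t => ?_
      rw [← ENNReal.tsum_add]
      refine tsum_congr fun s => ?_
      rw [← add_mul, hα1]
    have h2 : ∑' s, a s = ∑' s, (a s - ν s) + ∑' s, ν s := by
      rw [← ENNReal.tsum_add]
      exact tsum_congr fun s => (hα1 s).symm
    have h3 : ∑' s, (a s - ν s) ≠ ⊤ := by
      refine ne_top_of_le_ne_top (b := 1) (by simp) ?_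
      rw [← ha1]; exact ENNReal.tsum_le_tsum fun s => tsub_le_self
    simp_rw [ha] at h1
    rw [h2] at h1
    have h4 := hmassle (fun s => a s - ν s)
    have : ∑' s, (a s - ν s) + ∑' s, ν s ≤ ∑' s, (a s - ν s) + ∑' t, ∑' s, ν s * Q s t := by
      rw [h1]; gcongr
    exact (ENNReal.add_le_add_iff_left h3).1 this
  have hνQ : ∀ t, ∑' s, ν s * Q s t = ν t := by
    intro t
    refine le_antisymm (hνQle t) ?_
    by_contra h
    have := ENNReal.tsum_lt_tsum (f := fun t => ∑' s, ν s * Q s t) (g := ν) (by rw [hmass]; exact hνfin) hνQle (not_le.1 h)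
    rw [hmass] at this
    exact lt_irrefl _ this
  have hαQ : ∀ t, ∑' s, (a s - ν s) * Q s t = a t - ν t := by
    intro t
    have h1 : ∑' s, (a s - ν s) * Q s t + ν t = a t := by
      conv_rhs => rw [← ha t]
      rw [← hνQ t, ← ENNReal.tsum_add]
      refine tsum_congr fun s => ?_
      rw [← add_mul, hα1]
    have hνt : ν t ≠ ⊤ := ne_top_of_le_ne_top (hafin t) (hνa t)
    rw [← h1, ENNReal.add_sub_cancel_right hνt]
  by_cases h : ∃ s, a s - ν s ≠ 0
  · obtain ⟨s, hs⟩ := h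
    have hba : ∀ t, b t ≤ a t := by
      intro t
      by_cases hbt : b t = 0
      · simp [hbt]
      have := hacc _ (fun s => tsub_le_self) hαQ s t hs hbt
      by_contra hlt
      apply this
      rw [hν, min_eq_left (not_le.1 hlt).le, tsub_self]
    exact (hsq b a hba hb1 ha1).symm
  · push Not at h
    refine hsq a b (fun s => ?_) ha1 hb1
    exact (tsub_eq_zero_iff_le.1 (h s)).trans (hνb s)

/-- Moment bound. -/
lemma moment {S : Type*} (Q : S → S → ℝ≥0∞) (hQ : ∀ s, ∑' t, Q s t ≤ 1)
    (a : S → ℝ≥0∞) (ha1 : ∑' s, a s = 1)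
    (ha : ∀ t, ∑' s, a s * Q s t = a t) (h : S → ℕ) (B : ℝ≥0∞)
    (hd : ∀ s, a s ≠ 0 → ∑' t, Q s t * (h t : ℝ≥0∞) ≤ (h s : ℝ≥0∞) / 2 + B) :
    ∑' s, a s * (h s : ℝ≥0∞) ≤ 2 * B := by
  have key : ∀ N : ℕ, ∑' s, a s * (if h s ≤ N then (h s : ℝ≥0∞) / 2 else 0) ≤ B := by
    intro N
    have hQm : ∀ s, a s ≠ 0 → ∑' t, Q s t * min (h t : ℝ≥0∞) N ≤ min ((h s : ℝ≥0∞) / 2 + B) N := by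
      intro s hs
      refine le_min ((ENNReal.tsum_le_tsum fun t => ?_).trans (hd s hs)) ?_
      · gcongr; exact min_le_left _ _
      · calc ∑' t, Q s t * min (h t : ℝ≥0∞) N ≤ ∑' t, Q s t * N :=
              ENNReal.tsum_le_tsum fun t => by gcongr; exact min_le_right _ _
          _ = (∑' t, Q s t) * N := ENNReal.tsum_mul_right
          _ ≤ N := mul_le_of_le_one_left' (hQ s)
    have h1 : ∑' s, a s * min (h s : ℝ≥0∞) N ≤ ∑' s, a s * min ((h s : ℝ≥0∞) / 2 + B) N := by
      calc ∑' t, a t * min (h t : ℝ≥0∞) N = ∑' t, ∑' s, a s * (Q s t * min (h t : ℝ≥0∞) N) := by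
            refine tsum_congr fun t => ?_
            conv_lhs => rw [← ha t, ← ENNReal.tsum_mul_right]
            simp_rw [mul_assoc]
        _ = ∑' s, a s * ∑' t, Q s t * min (h t : ℝ≥0∞) N := by
            rw [ENNReal.tsum_comm]; simp_rw [ENNReal.tsum_mul_left]
        _ ≤ _ := ENNReal.tsum_le_tsum fun s => by
            by_cases hs : a s = 0
            · simp [hs]
            · gcongr; exact hQm s hs
    have h2 : ∑' s, a s * min ((h s : ℝ≥0∞) / 2 + B) N + ∑' s, a s * (if h s ≤ N then (h s : ℝ≥0∞) / 2 else 0)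
        ≤ ∑' s, a s * min (h s : ℝ≥0∞) N + B := by
      have hB : B = ∑' s, a s * B := by rw [ENNReal.tsum_mul_right, ha1, one_mul]
      conv_rhs => rw [hB]
      rw [← ENNReal.tsum_add, ← ENNReal.tsum_add]
      refine ENNReal.tsum_le_tsum fun s => ?_
      rw [← mul_add, ← mul_add]
      refine mul_le_mul' le_rfl ?_
      split_ifs with hN
      · have hN' : (h s : ℝ≥0∞) ≤ N := by exact_mod_cast hN
        rw [min_eq_left hN']
        calc min ((h s : ℝ≥0∞) / 2 + B) N + (h s : ℝ≥0∞) / 2 ≤ (h s : ℝ≥0∞) / 2 + B + (h s : ℝ≥0∞) / 2 := by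
              gcongr; exact min_le_left _ _
          _ = (h s : ℝ≥0∞) / 2 + (h s : ℝ≥0∞) / 2 + B := by ring
          _ = h s + B := by rw [ENNReal.add_halves]
      · have hN' : (N : ℝ≥0∞) ≤ h s := by exact_mod_cast (not_le.1 hN).le
        rw [min_eq_right hN', add_zero]
        exact (min_le_right _ _).trans le_self_add
    have hfin : ∑' s, a s * min ((h s : ℝ≥0∞) / 2 + B) N ≠ ⊤ := by
      refine ne_top_of_le_ne_top (b := N) (by simp) ?_
      calc ∑' s, a s * min ((h s : ℝ≥0∞) / 2 + B) N ≤ ∑' s, a s * N :=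
            ENNReal.tsum_le_tsum fun t => by gcongr; exact min_le_right _ _
        _ = N := by rw [ENNReal.tsum_mul_right, ha1, one_mul]
    have h3 := h2.trans (add_le_add_left h1 B)
    exact (ENNReal.add_le_add_iff_left hfin).1 h3
  have h4 : ∑' s, a s * ((h s : ℝ≥0∞) / 2) ≤ B := by
    rw [ENNReal.tsum_eq_iSup_sum]
    refine iSup_le fun I => ?_
    refine le_trans ?_ (key (I.sup h))
    refine le_trans (Finset.sum_le_sum fun s hs => ?_) (ENNReal.sum_le_tsum I)
    rw [if_pos (Finset.le_sup hs)]
  calc ∑' s, a s * (h s : ℝ≥0∞) = ∑' s, 2 * (a s * ((h s : ℝ≥0∞) / 2)) := by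
        refine tsum_congr fun s => ?_
        rw [mul_left_comm, ENNReal.mul_div_cancel (by simp) (by simp)]
    _ = 2 * ∑' s, a s * ((h s : ℝ≥0∞) / 2) := ENNReal.tsum_mul_left
    _ ≤ 2 * B := by gcongr

lemma measure_ext_cyl {S : Type*} [MeasurableSpace S] [Countable S] [MeasurableSingletonClass S]
    (μ ν : Measure (ℕ → S)) [IsFiniteMeasure μ] [IsFiniteMeasure ν]
    (h : ∀ (n : ℕ) (path : ℕ → S), μ {ω | ∀ k ≤ n, ω k = path k} = ν {ω | ∀ k ≤ n, ω k = path k}) :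
    μ = ν := by
  have hIic : ∀ n : ℕ, μ.map (Finset.Iic n).restrict = ν.map (Finset.Iic n).restrict := by
    intro n
    refine Measure.ext_of_singleton fun a => ?_
    rw [Measure.map_apply (by fun_prop) (measurableSet_singleton a),
      Measure.map_apply (by fun_prop) (measurableSet_singleton a)]
    have : (Finset.Iic n).restrict (π := fun _ => S) ⁻¹' {a} = {ω : ℕ → S | ∀ k ≤ n, ω k =
        (fun k => if hk : k ∈ Finset.Iic n then a ⟨k, hk⟩ else a ⟨0, by simp⟩) k} := by
      ext ω
      simp only [Set.mem_preimage, Set.mem_singleton_iff, Set.mem_ofPred_eq]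
      constructor
      · rintro rfl k hk
        simp [hk]
      · intro hω
        funext ⟨k, hk⟩
        have := hω k (Finset.mem_Iic.1 hk)
        simp only [hk, dif_pos] at this
        exact this
    rw [this]
    exact h n _
  have hI : IsProjectiveLimit μ (fun I => ν.map I.restrict) := by
    intro I
    have hsub : I ⊆ Finset.Iic (I.sup id) := Finset.subset_Iic_sup_id I
    rw [← Finset.restrict₂_comp_restrict hsub, ← Measure.map_map (by fun_prop) (by fun_prop), hIic,
      Measure.map_map (by fun_prop) (by fun_prop), Finset.restrict₂_comp_restrict hsub]
  exact hI.unique (fun I => rfl)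

/-- The event of exiting exactly at time `n`. -/
def exitAt {m : ℕ} (n : ℕ) : Set (ℕ → ℤ × Fin m) := {ω | (ω n).1 ≤ 0 ∧ ∀ j < n, 1 ≤ (ω j).1}

section paths
variable {m : ℕ}

lemma measurableSet_coord (n : ℕ) (A : Set (ℤ × Fin m)) :
    MeasurableSet {ω : ℕ → ℤ × Fin m | ω n ∈ A} :=
  measurable_pi_apply n (MeasurableSet.of_discrete (s := A))

lemma measurable_shift (n : ℕ) : Measurable fun (ω : ℕ → ℤ × Fin m) k => ω (k + n) := by
  fun_prop

lemma measurableSet_exitAt (n : ℕ) : MeasurableSet (exitAt (m := m) n) := by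
  have : exitAt (m := m) n = {ω | ω n ∈ {s : ℤ × Fin m | s.1 ≤ 0}} ∩
      ⋂ j : ℕ, ⋂ _ : j < n, {ω | ω j ∈ {s : ℤ × Fin m | 1 ≤ s.1}} := by
    ext ω; simp [exitAt]
  rw [this]
  exact (measurableSet_coord _ _).inter
    (MeasurableSet.iInter fun j => MeasurableSet.iInter fun _ => measurableSet_coord _ _)

lemma sigma_exitAt {n : ℕ} {ω : ℕ → ℤ × Fin m} (h : ω ∈ exitAt n) : sigmaT 0 ω = n := by
  simp only [sigmaT]
  refine le_antisymm (Nat.sInf_le h.1) ?_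
  refine le_csInf ⟨n, h.1⟩ fun k hk => ?_
  by_contra hlt
  have := h.2 k (not_le.1 hlt)
  simp only [Set.mem_ofPred_eq] at hk
  omega

lemma exitAt_of_exists {ω : ℕ → ℤ × Fin m} {k : ℕ} (h : (ω k).1 ≤ 0) : ω ∈ exitAt (sigmaT 0 ω) := by
  simp only [sigmaT]
  refine ⟨Nat.sInf_mem (s := {k : ℕ | (ω k).1 ≤ 0}) ⟨k, h⟩, fun j hj => ?_⟩
  have := Nat.notMem_of_lt_sInf hj
  simp only [Set.mem_ofPred_eq] at this
  omega

lemma measurable_sigma : Measurable (sigmaT (m := m) 0) := by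
  refine measurable_to_countable' fun n => ?_
  have : sigmaT (m := m) 0 ⁻¹' {n} = exitAt n ∪
      ({_ω | n = 0} ∩ ⋂ k : ℕ, {ω | ω k ∈ {s : ℤ × Fin m | 1 ≤ s.1}}) := by
    ext ω
    simp only [Set.mem_preimage, Set.mem_singleton_iff, Set.mem_union, Set.mem_inter_iff,
      Set.mem_ofPred_eq, Set.mem_iInter]
    constructor
    · intro h
      by_cases hex : ∃ k, (ω k).1 ≤ 0
      · obtain ⟨k, hk⟩ := hex
        left; rw [← h]; exact exitAt_of_exists hk
      · right
        push Not at hex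
        refine ⟨?_, fun k => hex k⟩
        rw [← h]
        simp only [sigmaT]
        have : {k : ℕ | (ω k).1 ≤ 0} = ∅ := by
          ext k; simp [hex k]
        rw [this, Nat.sInf_empty]
    · rintro (h | ⟨rfl, h⟩)
      · exact sigma_exitAt h
      · simp only [sigmaT]
        have : {k : ℕ | (ω k).1 ≤ 0} = ∅ := by
          ext k; have := h k; simp; omega
        rw [this, Nat.sInf_empty]
  rw [this]
  exact (measurableSet_exitAt n).union ((MeasurableSet.const _).inter
    (MeasurableSet.iInter fun k => measurableSet_coord _ _))

lemma measurable_at_sigma (j : ℕ) : Measurable fun ω : ℕ → ℤ × Fin m => ω (sigmaT 0 ω + j) := by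
  refine measurable_to_countable' fun t => ?_
  have : (fun ω : ℕ → ℤ × Fin m => ω (sigmaT 0 ω + j)) ⁻¹' {t} =
      ⋃ n : ℕ, (sigmaT 0 ⁻¹' {n} ∩ {ω | ω (n + j) ∈ ({t} : Set (ℤ × Fin m))}) := by
    ext ω; simp
  rw [this]
  exact MeasurableSet.iUnion fun n =>
    (measurable_sigma (measurableSet_singleton n)).inter (measurableSet_coord _ _)

variable (K : ℤ × Fin m → PMF (ℤ × Fin m))
    (P : ℤ × Fin m → Measure (ℕ → ℤ × Fin m))
    (hprob : ∀ s, IsProbabilityMeasure (P s))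
    (hcyl : ∀ (s : ℤ × Fin m) (n : ℕ) (path : ℕ → ℤ × Fin m),
      P s {ω | ∀ k ≤ n, ω k = path k} =
        (if path 0 = s then 1 else 0) *
          ∏ k ∈ Finset.range n, K (path k) (path (k + 1)))

include hprob hcyl

lemma P_start (s) : ∀ᵐ ω ∂P s, ω 0 = s := by
  have := hprob s
  have h := hcyl s 0 (fun _ => s)
  simp at h
  rw [← prob_compl_eq_zero_iff] at h
  · exact h
  · exact measurableSet_coord 0 {s}

lemma P_shift (s) : (P s).map (fun ω k => ω (k + 1)) = Measure.sum (fun u => K s u • P u) := by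
  have := hprob
  have hmeas := measurable_shift (m := m) 1
  have h1 : IsProbabilityMeasure ((P s).map (fun ω k => ω (k + 1))) :=
    Measure.isProbabilityMeasure_map hmeas.aemeasurable
  have h2 : IsProbabilityMeasure (Measure.sum (fun u => K s u • P u)) := by
    constructor
    rw [Measure.sum_apply _ MeasurableSet.univ]
    simp [(K s).tsum_coe]
  refine measure_ext_cyl _ _ fun n path => ?_
  have hms : MeasurableSet {ω : ℕ → ℤ × Fin m | ∀ k ≤ n, ω k = path k} := by
    have : {ω : ℕ → ℤ × Fin m | ∀ k ≤ n, ω k = path k} = ⋂ k : ℕ, ⋂ _ : k ≤ n, {ω | ω k ∈ ({path k} : Set (ℤ × Fin m))} := by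
      ext ω; simp
    rw [this]
    exact MeasurableSet.iInter fun j => MeasurableSet.iInter fun _ => measurableSet_coord _ _
  rw [Measure.map_apply hmeas hms, Measure.sum_apply _ hms]
  simp only [Measure.smul_apply, smul_eq_mul, hcyl]
  rw [tsum_eq_single (path 0)]
  · let path' : ℕ → ℤ × Fin m := fun k => Nat.casesOn k s path
    have h3 := hcyl s (n + 1) path'
    have h4 : P s ((fun ω k => ω (k + 1)) ⁻¹' {ω | ∀ k ≤ n, ω k = path k}) = P s {ω | ∀ k ≤ n + 1, ω k = path' k} := by
      refine measure_congr ?_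
      filter_upwards [P_start K P hprob hcyl s] with ω hω
      refine propext ⟨fun h k hk => ?_, fun h k hk => ?_⟩
      · cases k with
        | zero => exact hω
        | succ k => exact h k (by omega)
      · exact h (k + 1) (by omega)
    rw [h4, h3, Finset.prod_range_succ']
    simp [path', mul_comm]
  · intro u hu
    simp [hu.symm]

lemma lintegral_shift (s) (Ψ : (ℕ → ℤ × Fin m) → ℝ≥0∞) (hΨ : Measurable Ψ) :
    ∫⁻ ω, Ψ (fun k => ω (k + 1)) ∂P s = KF K (fun u => ∫⁻ ω, Ψ ω ∂P u) s := by
  rw [← lintegral_map hΨ (measurable_shift 1), P_shift K P hprob hcyl, lintegral_sum_measure]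
  simp [KF]

lemma strong_markov (Ψ : (ℕ → ℤ × Fin m) → ℝ≥0∞) (hΨ : Measurable Ψ) (n : ℕ) :
    ∀ s, ∫⁻ ω, (exitAt n).indicator (fun ω => Ψ (fun k => ω (k + n))) ω ∂P s =
      hop K (fun t => ∫⁻ ω, Ψ ω ∂P t) n s := by
  classical
  have := hprob
  induction n with
  | zero =>
    intro s
    simp only [hop]
    split_ifs with h
    · refine lintegral_congr_ae ?_
      filter_upwards [P_start K P hprob hcyl s] with ω hω
      rw [Set.indicator_of_mem]
      · simp
      · simp [exitAt, hω, h]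
    · rw [← lintegral_zero (μ := P s)]
      refine lintegral_congr_ae ?_
      filter_upwards [P_start K P hprob hcyl s] with ω hω
      rw [Set.indicator_of_notMem]
      simp [exitAt, hω]; omega
  | succ n ih =>
    intro s
    simp only [hop]
    split_ifs with h
    · rw [← lintegral_zero (μ := P s)]
      refine lintegral_congr_ae ?_
      filter_upwards [P_start K P hprob hcyl s] with ω hω
      rw [Set.indicator_of_notMem]
      rintro ⟨_, h2⟩
      have := h2 0 (by omega)
      rw [hω] at this; omega
    · have hm : Measurable fun ω : ℕ → ℤ × Fin m => (exitAt n).indicator (fun ω => Ψ (fun k => ω (k + n))) ω :=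
        (hΨ.comp (measurable_shift n)).indicator (measurableSet_exitAt n)
      have h2 := lintegral_shift K P hprob hcyl s _ hm
      rw [show (fun u => ∫⁻ ω, (exitAt n).indicator (fun ω => Ψ (fun k => ω (k + n))) ω ∂P u) = _ from funext ih] at h2
      rw [← h2]
      refine lintegral_congr_ae ?_
      filter_upwards [P_start K P hprob hcyl s] with ω hω
      have hiff : (fun k => ω (k + 1)) ∈ exitAt n ↔ ω ∈ exitAt (n + 1) := by
        simp only [exitAt, Set.mem_ofPred_eq]
        refine and_congr Iff.rfl ⟨fun hj j hjn => ?_, fun hj j hjn => hj (j + 1) (by omega)⟩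
        cases j with
        | zero => rw [hω]; omega
        | succ j => exact hj j (by omega)
      by_cases hmem : ω ∈ exitAt (n + 1)
      · rw [Set.indicator_of_mem hmem, Set.indicator_of_mem (hiff.2 hmem)]
        simp only [add_assoc]
      · rw [Set.indicator_of_notMem hmem, Set.indicator_of_notMem (fun hh => hmem (hiff.1 hh))]

lemma ae_exit (s) (hrec : HF K (fun _ => 1) s = 1) : ∀ᵐ ω ∂P s, ω ∈ exitAt (sigmaT 0 ω) := by
  have := hprob
  have h1 : P s (⋃ n, exitAt n) = 1 := by
    rw [measure_iUnion _ measurableSet_exitAt, ← hrec]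
    · unfold HF
      refine tsum_congr fun n => ?_
      have := strong_markov K P hprob hcyl (fun _ => 1) measurable_const n s
      simp only [lintegral_one, measure_univ] at this
      rw [← this]
      rw [lintegral_indicator (measurableSet_exitAt n)]; simp
    · intro i j hij
      refine Set.disjoint_left.2 fun ω hi hj => hij ?_
      rw [← sigma_exitAt hi, ← sigma_exitAt hj]
  rw [← prob_compl_eq_zero_iff (MeasurableSet.iUnion measurableSet_exitAt)] at h1
  have h2 : ∀ᵐ ω ∂P s, ω ∈ ⋃ n, exitAt n := h1
  filter_upwards [h2] with ω hω
  obtain ⟨n, hn⟩ := Set.mem_iUnion.1 hω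
  rw [sigma_exitAt hn]; exact hn

lemma lintegral_exit (s) (hrec : HF K (fun _ => 1) s = 1)
    (Ψ : (ℕ → ℤ × Fin m) → ℝ≥0∞) (hΨ : Measurable Ψ) :
    ∫⁻ ω, Ψ (fun k => ω (sigmaT 0 ω + k)) ∂P s = HF K (fun t => ∫⁻ ω, Ψ ω ∂P t) s := by
  unfold HF
  simp_rw [← strong_markov K P hprob hcyl Ψ hΨ]
  have hmn : ∀ n, Measurable fun ω : ℕ → ℤ × Fin m =>
      (exitAt n).indicator (fun ω => Ψ (fun k => ω (k + n))) ω := fun n =>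
    (hΨ.comp (measurable_shift n)).indicator (measurableSet_exitAt n)
  rw [← lintegral_tsum (fun n => (hmn n).aemeasurable)]
  refine lintegral_congr_ae ?_
  filter_upwards [ae_exit K P hprob hcyl s hrec] with ω hω
  rw [tsum_eq_single (sigmaT 0 ω)]
  · rw [Set.indicator_of_mem hω]; simp_rw [add_comm]
  · intro n hn
    rw [Set.indicator_of_notMem]
    intro h; exact hn (sigma_exitAt h).symm

lemma P_coord0 (s) (F : ℤ × Fin m → ℝ≥0∞) : ∫⁻ ω, F (ω 0) ∂P s = F s := by
  have := hprob
  have : ∫⁻ ω, F (ω 0) ∂P s = ∫⁻ ω, F s ∂P s := by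
    refine lintegral_congr_ae ?_
    filter_upwards [P_start K P hprob hcyl s] with ω hω
    rw [hω]
  rw [this]; simp

lemma P_coord1 (s) (F : ℤ × Fin m → ℝ≥0∞) : ∫⁻ ω, F (ω 1) ∂P s = KF K F s := by
  have := lintegral_shift K P hprob hcyl s (fun ω => F (ω 0)) (by fun_prop)
  simp only [zero_add, P_coord0 K P hprob hcyl] at this
  exact this

lemma lintegral_at_exit (hrec : ∀ s, HF K (fun _ => 1) s = 1) (s) (F : ℤ × Fin m → ℝ≥0∞) :
    ∫⁻ ω, F (ω (sigmaT 0 ω)) ∂P s = HF K F s := by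
  have := lintegral_exit K P hprob hcyl s (hrec s) (fun ω => F (ω 0)) (by fun_prop)
  simp only [add_zero, P_coord0 K P hprob hcyl] at this
  exact this

lemma lintegral_at_ent (hrec : ∀ s, HF K (fun _ => 1) s = 1) (s) (F : ℤ × Fin m → ℝ≥0∞) :
    ∫⁻ ω, F (ω (sigmaT 0 ω + 1)) ∂P s = HF K (KF K F) s := by
  have := lintegral_exit K P hprob hcyl s (hrec s) (fun ω => F (ω 1)) (by fun_prop)
  simp only [P_coord1 K P hprob hcyl] at this
  exact this

lemma P_ent (hrec : ∀ s, HF K (fun _ => 1) s = 1) (s) (A : Set (ℤ × Fin m)) :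
    P s {ω | ω (sigmaT 0 ω + 1) ∈ A} = HF K (KF K (A.indicator 1)) s := by
  rw [← lintegral_at_ent K P hprob hcyl hrec, ← lintegral_indicator_one]
  · rfl
  · exact measurable_at_sigma 1 (MeasurableSet.of_discrete (s := A))

lemma P_exit2 (hrec : ∀ s, HF K (fun _ => 1) s = 1) (s : ℤ × Fin m) (hs : s.1 ≤ 0)
    (A : Set (ℤ × Fin m)) :
    P s {ω | ω (sigmaT 1 ω) ∈ A} = KF K (HF K (A.indicator 1)) s := by
  have := hprob
  have hm : Measurable fun ω : ℕ → ℤ × Fin m => ω (sigmaT 0 ω) := measurable_at_sigma 0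
  have hmA : MeasurableSet {ω : ℕ → ℤ × Fin m | ω (sigmaT 0 ω) ∈ A} := hm (MeasurableSet.of_discrete (s := A))
  have hF : (HF K (A.indicator 1)) = fun u => ∫⁻ ω, A.indicator 1 (ω (sigmaT 0 ω)) ∂P u :=
    funext fun u => (lintegral_at_exit K P hprob hcyl hrec u _).symm
  rw [hF, ← lintegral_shift K P hprob hcyl s (fun ω => A.indicator 1 (ω (sigmaT 0 ω)))
    ((measurable_of_countable (A.indicator (1 : ℤ × Fin m → ℝ≥0∞))).comp hm)]
  have hae : ∀ᵐ ω ∂P s, (fun k => ω (k + 1)) ∈ exitAt (sigmaT 0 (fun k => ω (k + 1))) := by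
    have h1 : ∀ᵐ ω ∂((P s).map (fun ω k => ω (k + 1))), ω ∈ exitAt (sigmaT 0 ω) := by
      rw [P_shift K P hprob hcyl]
      rw [Measure.ae_sum_iff]
      intro u
      exact Measure.ae_smul_measure (ae_exit K P hprob hcyl u (hrec u)) _
    exact ae_of_ae_map (measurable_shift 1).aemeasurable h1
  have hset : P s {ω | ω (sigmaT 1 ω) ∈ A} =
      P s ((fun ω k => ω (k + 1)) ⁻¹' {ω : ℕ → ℤ × Fin m | ω (sigmaT 0 ω) ∈ A}) := by
    refine measure_congr ?_
    filter_upwards [hae, P_start K P hprob hcyl s] with ω hω h0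
    have hs0 : sigmaT 0 ω = 0 := sigma_exitAt ⟨by rw [h0]; exact hs, by simp⟩
    have hs1 : sigmaT 1 ω = sigmaT 0 (fun k => ω (k + 1)) + 1 := by
      obtain ⟨n, hn⟩ : ∃ n, n = sigmaT 0 (fun k => ω (k + 1)) := ⟨_, rfl⟩
      rw [← hn] at hω ⊢
      change sInf {k : ℕ | sigmaT 0 ω < k ∧ (ω k).1 ≤ 0} = n + 1
      rw [hs0]
      refine le_antisymm (Nat.sInf_le ⟨by omega, hω.1⟩) ?_
      refine le_csInf ⟨n + 1, ⟨by omega, hω.1⟩⟩ fun k hk => ?_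
      by_contra hlt
      obtain ⟨j, rfl⟩ : ∃ j, k = j + 1 := ⟨k - 1, by have := hk.1; omega⟩
      have h3 := hω.2 j (by omega)
      have h4 := hk.2
      simp only at h3
      omega
    change (ω (sigmaT 1 ω) ∈ A) = (ω (sigmaT 0 (fun k => ω (k + 1)) + 1) ∈ A)
    rw [hs1]
  rw [hset, ← lintegral_indicator_one (measurable_shift 1 hmA)]
  rfl

end paths

lemma tsum_measure_singleton {S : Type*} [MeasurableSpace S] [Countable S] [MeasurableSingletonClass S]
    (μ : Measure S) [IsProbabilityMeasure μ] : ∑' s, μ {s} = 1 := by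
  have := lintegral_countable' (μ := μ) (fun _ => 1)
  simpa using this.symm

lemma K_pos_eq {m : ℕ} (K : ℤ × Fin m → PMF (ℤ × Fin m)) (ξ : Fin m → PMF ℤ)
    (hA1 : ∀ x : ℤ, 1 ≤ x → ∀ (i : Fin m) (y : ℤ), K (x, i) (x + y, i) = ξ i y)
    (x : ℤ) (hx : 1 ≤ x) (i : Fin m) (u : ℤ × Fin m) (hu : u.2 ≠ i) : K (x, i) u = 0 := by
  classical
  have hinj : Function.Injective fun y : ℤ => ((x + y, i) : ℤ × Fin m) := by
    intro y z h
    simp only [Prod.mk.injEq] at h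
    omega
  have h1 : ∑' u : ℤ × Fin m, (if u.2 = i then K (x, i) u else 0) = 1 := by
    rw [← hinj.tsum_eq (f := fun u : ℤ × Fin m => if u.2 = i then K (x, i) u else 0)]
    · simp [hA1 x hx i, (ξ i).tsum_coe]
    · intro u hu
      simp only [Function.mem_support, ne_eq, ite_eq_right_iff, Classical.not_imp] at hu
      exact ⟨u.1 - x, by ext <;> simp [hu.1]⟩
  by_contra h
  have := ENNReal.tsum_lt_tsum (f := fun u : ℤ × Fin m => if u.2 = i then K (x, i) u else 0)
    (g := K (x, i)) (i := u) (by rw [h1]; simp) (fun u => by split_ifs <;> simp)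
    (by simp only [hu, if_false]; exact pos_iff_ne_zero.2 h)
  rw [h1, (K (x, i)).tsum_coe] at this
  exact lt_irrefl _ this

lemma KF_pos_eq {m : ℕ} (K : ℤ × Fin m → PMF (ℤ × Fin m)) (ξ : Fin m → PMF ℤ)
    (hA1 : ∀ x : ℤ, 1 ≤ x → ∀ (i : Fin m) (y : ℤ), K (x, i) (x + y, i) = ξ i y)
    (x : ℤ) (hx : 1 ≤ x) (i : Fin m) (F : ℤ × Fin m → ℝ≥0∞) :
    KF K F (x, i) = ∑' y, ξ i y * F (x + y, i) := by
  have hinj : Function.Injective fun y : ℤ => ((x + y, i) : ℤ × Fin m) := by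
    intro y z h
    simp only [Prod.mk.injEq] at h
    omega
  unfold KF
  rw [← hinj.tsum_eq (f := fun u => K (x, i) u * F u)]
  · simp [hA1 x hx i]
  · intro u hu
    have : u.2 = i := by
      by_contra h
      simp [K_pos_eq K ξ hA1 x hx i u h] at hu
    exact ⟨u.1 - x, by ext <;> simp [this]⟩

lemma pmf_hasSum (ξ : PMF ℤ) : HasSum (fun y => (ξ y).toReal) 1 := by
  have h := ENNReal.hasSum_toReal (f := ξ) (by rw [ξ.tsum_coe]; simp)
  rw [← ENNReal.tsum_toReal_eq (fun y => ξ.apply_ne_top y), ξ.tsum_coe] at h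
  simpa using h

lemma pmf_ofReal (ξ : PMF ℤ) (g : ℤ → ℝ) (hg : ∀ y, 0 ≤ g y)
    (hs : Summable fun y => (ξ y).toReal * g y) :
    ∑' y, ξ y * ENNReal.ofReal (g y) = ENNReal.ofReal (∑' y, (ξ y).toReal * g y) := by
  rw [ENNReal.ofReal_tsum_of_nonneg (fun y => mul_nonneg ENNReal.toReal_nonneg (hg y)) hs]
  refine tsum_congr fun y => ?_
  rw [ENNReal.ofReal_mul ENNReal.toReal_nonneg, ENNReal.ofReal_toReal (ξ.apply_ne_top y)]

lemma HF_le_one {m : ℕ} (K : ℤ × Fin m → PMF (ℤ × Fin m)) (s) : HF K (fun _ => 1) s ≤ 1 :=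
  HF_le K _ (fun _ => 1) (fun _ _ => le_rfl) (fun s _ => (KF_one K s).le) s

lemma HF_rec {m : ℕ} (K : ℤ × Fin m → PMF (ℤ × Fin m)) (ξ : Fin m → PMF ℤ)
    (hA1 : ∀ x : ℤ, 1 ≤ x → ∀ (i : Fin m) (y : ℤ), K (x, i) (x + y, i) = ξ i y)
    (hint : ∀ i, Summable fun y : ℤ => |(y : ℝ)| * (ξ i y).toReal)
    (hmean : ∀ i, ∑' y : ℤ, (y : ℝ) * (ξ i y).toReal = 0)
    (hsq : ∀ i, Summable fun y : ℤ => (y : ℝ) ^ 2 * (ξ i y).toReal)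
    (hvar : ∀ i, 0 < ∑' y : ℤ, (y : ℝ) ^ 2 * (ξ i y).toReal) (s) : HF K (fun _ => 1) s = 1 := by
  obtain ⟨x, i⟩ := s
  obtain ⟨f, B, δ, hδ, hB, hf0, hfn, hfδ, hfB, hfs, hfsup⟩ :=
    lyap (fun y => (ξ i y).toReal) (fun y => ENNReal.toReal_nonneg) (pmf_hasSum (ξ i)) (hint i) (hmean i) (hsq i) (hvar i) 1 one_pos
  have hne : ∀ s, HF K (fun _ => 1) s ≠ ⊤ := fun s => ne_top_of_le_ne_top (by simp) (HF_le_one K s)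
  have hle : ∀ s, (HF K (fun _ => 1) s).toReal ≤ 1 := fun s => by
    have := ENNReal.toReal_mono (by simp) (HF_le_one K s)
    simpa using this
  have hw1 := pmf_hasSum (ξ i)
  have := max_principle (fun y => (ξ i y).toReal) (fun y => ENNReal.toReal_nonneg) (pmf_hasSum (ξ i)) f δ hδ hf0 hfδ hfs hfsup
    (fun x => 1 - (HF K (fun _ => 1) (x, i)).toReal) (fun x => by linarith [hle (x, i)])
    (fun x => by linarith [ENNReal.toReal_nonneg (a := HF K (fun _ => 1) (x, i))])
    (fun x hx => by simp [HF_nonpos K _ (x, i) hx])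
    (fun x hx => by
      have h1 := HF_pos K (fun _ => 1) (x, i) hx
      rw [KF_pos_eq K ξ hA1 x hx i] at h1
      have hs : Summable fun y => (ξ i y).toReal * (HF K (fun _ => 1) (x + y, i)).toReal :=
        Summable.of_nonneg_of_le (fun y => by positivity)
          (fun y => mul_le_of_le_one_right ENNReal.toReal_nonneg (hle _)) hw1.summable
      rw [h1, ENNReal.tsum_toReal_eq (fun y => ENNReal.mul_ne_top ((ξ i).apply_ne_top y) (hne _))]
      simp_rw [ENNReal.toReal_mul, mul_sub, mul_one]
      rw [hw1.summable.tsum_sub hs, hw1.tsum_eq]) x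
  have h3 : (HF K (fun _ => 1) (x, i)).toReal = 1 := by linarith
  rw [← ENNReal.ofReal_toReal (hne (x, i)), h3]; simp

lemma HF_bound {m : ℕ} (K : ℤ × Fin m → PMF (ℤ × Fin m)) (ξ : Fin m → PMF ℤ)
    (hA1 : ∀ x : ℤ, 1 ≤ x → ∀ (i : Fin m) (y : ℤ), K (x, i) (x + y, i) = ξ i y)
    (hint : ∀ i, Summable fun y : ℤ => |(y : ℝ)| * (ξ i y).toReal)
    (hmean : ∀ i, ∑' y : ℤ, (y : ℝ) * (ξ i y).toReal = 0)
    (hsq : ∀ i, Summable fun y : ℤ => (y : ℝ) ^ 2 * (ξ i y).toReal)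
    (hvar : ∀ i, 0 < ∑' y : ℤ, (y : ℝ) ^ 2 * (ξ i y).toReal) (ε : ℝ) (hε : 0 < ε) :
    ∃ B : ℝ, 0 ≤ B ∧ ∀ c : ℝ, 0 ≤ c → ∀ s : ℤ × Fin m, 1 ≤ s.1 →
      HF K (fun t => ENNReal.ofReal (c * (1 + |(t.1 : ℝ)|))) s ≤ ENNReal.ofReal (c * (1 + ε * s.1 + B)) := by
  have hl := fun i => lyap (fun y => (ξ i y).toReal) (fun y => ENNReal.toReal_nonneg) (pmf_hasSum (ξ i)) (hint i) (hmean i) (hsq i) (hvar i) ε hε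
  choose f B δ hδ hB hf0 hfn hfδ hfB hfs hfsup using hl
  refine ⟨∑ i, B i, Finset.sum_nonneg fun i _ => hB i, fun c hc s hs => ?_⟩
  refine (HF_le K _ (fun t => ENNReal.ofReal (c * (1 + f t.2 t.1))) ?_ ?_ s).trans ?_
  · intro t ht
    refine ENNReal.ofReal_le_ofReal (mul_le_mul_of_nonneg_left ?_ hc)
    linarith [hfn t.2 t.1 ht]
  · rintro ⟨x, i⟩ hx
    have hw1 := pmf_hasSum (ξ i)
    rw [KF_pos_eq K ξ hA1 x hx i]
    have heq : ∀ y, (ξ i y).toReal * (c * (1 + f i (x + y))) = c * ((ξ i y).toReal + (ξ i y).toReal * f i (x + y)) := fun y => by ring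
    have hsm : Summable fun y => (ξ i y).toReal * (c * (1 + f i (x + y))) := by
      simp_rw [heq]
      exact (hw1.summable.add (hfs i x)).mul_left c
    rw [pmf_ofReal (ξ i) (fun y => c * (1 + f i (x + y))) (fun y => mul_nonneg hc (by linarith [hf0 i (x + y)])) hsm]
    refine ENNReal.ofReal_le_ofReal ?_
    simp_rw [heq]
    rw [tsum_mul_left, hw1.summable.tsum_add (hfs i x), hw1.tsum_eq]
    exact mul_le_mul_of_nonneg_left (by linarith [hfsup i x hx]) hc
  · refine ENNReal.ofReal_le_ofReal (mul_le_mul_of_nonneg_left ?_ hc)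
    have := Finset.single_le_sum (f := B) (fun i _ => hB i) (Finset.mem_univ s.2)
    linarith [hfB s.2 s.1 hs]

lemma KF_indicator {m : ℕ} (K : ℤ × Fin m → PMF (ℤ × Fin m)) (t s) :
    KF K (Set.indicator {t} 1) s = K s t := by
  unfold KF
  rw [tsum_eq_single t]
  · simp
  · intro u hu; simp [hu]

lemma fun_eq_tsum {S : Type*} (F : S → ℝ≥0∞) :
    F = fun s => ∑' t, F t * (Set.indicator {t} (1 : S → ℝ≥0∞) s) := by
  funext s
  rw [tsum_eq_single s]
  · simp
  · intro u hu; simp [hu.symm]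

/-- Accessibility. -/
lemma access {m : ℕ} (K : ℤ × Fin m → PMF (ℤ × Fin m))
    (hA4 : ∀ s s' : ℤ × Fin m, 1 ≤ s.1 → 1 ≤ s'.1 → ∃ n : ℕ, iterK K n s s' ≠ 0)
    (μ : ℤ × Fin m → ℝ≥0∞) (hμ : ∀ t, ∑' s, μ s * HF K (fun t' => K t' t) s = μ t)
    (s u : ℤ × Fin m) (hs : μ s ≠ 0) (hs1 : 1 ≤ s.1) (hu : 1 ≤ u.1) :
    ∃ s', μ s' ≠ 0 ∧ ∀ F, HF K F s' = 0 → HF K F u = 0 := by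
  have hstep : ∀ u u', (∃ s', μ s' ≠ 0 ∧ ∀ F, HF K F s' = 0 → HF K F u = 0) → K u u' ≠ 0 →
      (∃ s', μ s' ≠ 0 ∧ ∀ F, HF K F s' = 0 → HF K F u' = 0) := by
    rintro u u' ⟨s', hs', hF⟩ hK
    by_cases h : u.1 ≤ 0
    · refine ⟨u', ?_, fun F h => h⟩
      rw [← hμ u']
      intro h0
      rw [ENNReal.tsum_eq_zero] at h0
      have h1 := (mul_eq_zero.1 (h0 s')).resolve_left hs'
      have h2 := hF _ h1
      rw [HF_nonpos K _ u h] at h2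
      exact hK h2
    · refine ⟨s', hs', fun F h0 => ?_⟩
      have h1 := hF F h0
      rw [HF_pos K F u (by omega)] at h1
      unfold KF at h1
      rw [ENNReal.tsum_eq_zero] at h1
      exact (mul_eq_zero.1 (h1 u')).resolve_left hK
  have hiter : ∀ n u, iterK K n s u ≠ 0 → ∃ s', μ s' ≠ 0 ∧ ∀ F, HF K F s' = 0 → HF K F u = 0 := by
    intro n
    induction n with
    | zero =>
      intro u hu
      have : u = s := by
        by_contra h
        simp [iterK, h] at hu
      exact ⟨s, hs, by rw [this]; exact fun F h => h⟩
    | succ n ih =>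
      intro u hu
      simp only [iterK, PMF.bind_apply, ne_eq, ENNReal.tsum_eq_zero, not_forall, mul_eq_zero, not_or] at hu
      obtain ⟨w, hw1, hw2⟩ := hu
      exact hstep w u (ih w hw1) hw2
  obtain ⟨n, hn⟩ := hA4 s u hs1 hu
  exact hiter n u hn

lemma X_eq {m : ℕ} (P : ℤ × Fin m → Measure (ℕ → ℤ × Fin m)) (hprob : ∀ s, IsProbabilityMeasure (P s))
    (π ν₁ ν₂ : Measure (ℤ × Fin m))
    [IsProbabilityMeasure π]
    (T U : (ℕ → ℤ × Fin m) → ℤ × Fin m) (hT : Measurable T) (hU : Measurable U)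
    (hT1 : ∀ F : ℤ × Fin m → ℝ≥0∞, ∑' s, π {s} * ∫⁻ ω, F (T ω) ∂P s = ∑' s, ν₁ {s} * F s)
    (hU1 : ∀ F : ℤ × Fin m → ℝ≥0∞, ∑' s, π {s} * ∫⁻ ω, F (U ω) ∂P s = ∑' s, ν₂ {s} * F s)
    (G : ℤ × Fin m → ℝ) (hG1 : Integrable G ν₁) (hG2 : Integrable G ν₂)
    (I : (ℕ → ℤ × Fin m) → ℝ) (hI : ∀ s, π {s} ≠ 0 → ∀ᵐ ω ∂P s, I ω = G (T ω) - G (U ω)) :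
    ∑' s, (π {s}).toReal * ∫ ω, I ω ∂P s =
      ∑' s, G s * (ν₁ {s}).toReal - ∑' s, G s * (ν₂ {s}).toReal := by
  let M : Measure (ℕ → ℤ × Fin m) := Measure.sum (fun s => π {s} • P s)
  have hmap : ∀ (V : (ℕ → ℤ × Fin m) → ℤ × Fin m) (ν : Measure (ℤ × Fin m)), Measurable V →
      (∀ F : ℤ × Fin m → ℝ≥0∞, ∑' s, π {s} * ∫⁻ ω, F (V ω) ∂P s = ∑' s, ν {s} * F s) → M.map V = ν := by
    intro V ν hV h
    refine Measure.ext_of_singleton fun t => ?_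
    have h1 := h (Set.indicator {t} 1)
    rw [Measure.map_apply hV (measurableSet_singleton t), Measure.sum_apply _ (hV (measurableSet_singleton t))]
    have h2 : ∑' s, ν {s} * Set.indicator {t} (1 : ℤ × Fin m → ℝ≥0∞) s = ν {t} := by
      rw [tsum_eq_single t]
      · simp
      · intro u hu; simp [hu]
    rw [← h2, ← h1]
    refine tsum_congr fun s => ?_
    rw [Measure.smul_apply, smul_eq_mul, ← lintegral_indicator_one (hV (measurableSet_singleton t))]
    rfl
  have hGm : Measurable G := measurable_of_countable G
  have hi : ∀ (V : (ℕ → ℤ × Fin m) → ℤ × Fin m) (ν : Measure (ℤ × Fin m)), Measurable V →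
      M.map V = ν → Integrable G ν → Integrable (fun ω => G (V ω)) M ∧
        ∫ ω, G (V ω) ∂M = ∑' s, G s * (ν {s}).toReal := by
    intro V ν hV h hGi
    rw [← h] at hGi
    refine ⟨hGi.comp_measurable hV, ?_⟩
    rw [← integral_map hV.aemeasurable hGm.aestronglyMeasurable, integral_countable hGi, h]
    refine tsum_congr fun s => ?_
    rw [smul_eq_mul, mul_comm]; rfl
  obtain ⟨i1, e1⟩ := hi T ν₁ hT (hmap T ν₁ hT hT1) hG1
  obtain ⟨i2, e2⟩ := hi U ν₂ hU (hmap U ν₂ hU hU1) hG2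
  have h3 : Integrable (fun ω => G (T ω) - G (U ω)) M := i1.sub i2
  have h4 : ∫ ω, (G (T ω) - G (U ω)) ∂M = ∑' s, ∫ ω, (G (T ω) - G (U ω)) ∂(π {s} • P s) :=
    integral_sum_measure h3
  rw [← e1, ← e2, ← integral_sub i1 i2, h4]
  refine tsum_congr fun s => ?_
  rw [integral_smul_measure, smul_eq_mul]
  by_cases hs : π {s} = 0
  · simp [hs]
  · rw [integral_congr_ae (hI s hs)]

lemma G_int {m : ℕ} (μ : Measure (ℤ × Fin m)) (hmom : ∑' s, μ {s} * ENNReal.ofReal |(s.1 : ℝ)| ≠ ⊤)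
    (G : ℤ × Fin m → ℝ) (c : ℝ) (hc : 0 ≤ c) (hG : ∀ s, |G s| ≤ c * |(s.1 : ℝ)|) :
    Integrable G μ ∧ Summable fun s => G s * (μ {s}).toReal := by
  have h1 : ∑' s, ‖G s‖ₑ * μ {s} ≠ ⊤ := by
    refine ne_top_of_le_ne_top (ENNReal.mul_ne_top (ENNReal.ofReal_ne_top (r := c)) hmom) ?_
    rw [← ENNReal.tsum_mul_left]
    refine ENNReal.tsum_le_tsum fun s => ?_
    rw [← ofReal_norm, Real.norm_eq_abs]
    calc ENNReal.ofReal |G s| * μ {s} ≤ ENNReal.ofReal (c * |(s.1 : ℝ)|) * μ {s} := by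
          gcongr; exact hG s
      _ = _ := by rw [ENNReal.ofReal_mul hc]; ring
  refine ⟨⟨(measurable_of_countable G).aestronglyMeasurable, ?_⟩, ?_⟩
  · rw [hasFiniteIntegral_iff_enorm, lintegral_countable']
    exact h1.lt_top
  · refine Summable.of_norm ?_
    refine (ENNReal.summable_toReal h1).congr fun s => ?_
    simp

lemma Q_sum {m : ℕ} (K : ℤ × Fin m → PMF (ℤ × Fin m)) (hrec : ∀ s, HF K (fun _ => 1) s = 1) (s) :
    ∑' t, HF K (fun t' => K t' t) s = 1 := by
  have h := HF_tsum K (fun _ : ℤ × Fin m => 1) (fun t t' => K t' t) s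
  simp only [one_mul, PMF.tsum_coe] at h
  rw [← h, hrec]

lemma Q_KF {m : ℕ} (K : ℤ × Fin m → PMF (ℤ × Fin m)) (G : ℤ × Fin m → ℝ≥0∞) (s) :
    ∑' t, HF K (fun t' => K t' t) s * G t = HF K (KF K G) s := by
  have h := HF_tsum K G (fun t t' => K t' t) s
  simp_rw [mul_comm _ (G _)]
  rw [← h]
  congr 1
  funext t
  unfold KF
  simp_rw [mul_comm]

lemma core {m : ℕ} (K : ℤ × Fin m → PMF (ℤ × Fin m)) (hrec : ∀ s, HF K (fun _ => 1) s = 1)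
    (hA2 : ∀ x : ℤ, x ≤ 0 → ∀ i : Fin m, ∀ s' : ℤ × Fin m, K (x, i) s' ≠ 0 → 1 ≤ s'.1)
    (hA4 : ∀ s s' : ℤ × Fin m, 1 ≤ s.1 → 1 ≤ s'.1 → ∃ n : ℕ, iterK K n s s' ≠ 0)
    (a b : ℤ × Fin m → ℝ≥0∞) (ha1 : ∑' s, a s = 1) (hb1 : ∑' s, b s = 1)
    (ha0 : ∀ s, a s ≠ 0 → 1 ≤ s.1) (hb0 : ∀ s, b s ≠ 0 → s.1 ≤ 0)
    (hent : ∀ t, ∑' s, a s * HF K (fun t' => K t' t) s = a t)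
    (hexit : ∀ t, ∑' s, b s * KF K (HF K (Set.indicator {t} 1)) s = b t) :
    (∀ G : ℤ × Fin m → ℝ≥0∞, ∑' s, b s * KF K G s = ∑' s, a s * G s) ∧
    (∀ F : ℤ × Fin m → ℝ≥0∞, ∑' s, a s * HF K F s = ∑' s, b s * F s) := by
  have hexF : ∀ F : ℤ × Fin m → ℝ≥0∞, ∑' s, b s * KF K (HF K F) s = ∑' t, b t * F t := by
    intro F
    have h1 : ∀ s, KF K (HF K F) s = ∑' t, F t * KF K (HF K (Set.indicator {t} 1)) s := by
      intro s
      rw [← KF_tsum]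
      congr 1
      funext u
      conv_lhs => rw [fun_eq_tsum F]
      exact HF_tsum K F _ u
    simp_rw [h1, ← ENNReal.tsum_mul_left]
    rw [ENNReal.tsum_comm]
    refine tsum_congr fun t => ?_
    rw [← hexit t, ← ENNReal.tsum_mul_right]
    exact tsum_congr fun s => by ring
  have hb'KF : ∀ G : ℤ × Fin m → ℝ≥0∞, ∑' u, (∑' s, b s * K s u) * G u = ∑' s, b s * KF K G s := by
    intro G
    unfold KF
    simp_rw [← ENNReal.tsum_mul_left, ← ENNReal.tsum_mul_right]
    rw [ENNReal.tsum_comm]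
    exact tsum_congr fun t => tsum_congr fun s => by ring
  have hab : a = fun u => ∑' s, b s * K s u := by
    refine invDist_unique (fun s t => HF K (fun t' => K t' t) s) (fun s => (Q_sum K hrec s).le) a _ ha1 ?_ hent ?_ ?_
    · have := hb'KF (fun _ => 1)
      simp only [KF_one, mul_one] at this
      rw [this, hb1]
    · intro t
      rw [hb'KF, hexF]
    · intro μ hμa hμ s t hs ht h0
      have hinv : ∑' u, (∑' s, b s * K s u) * HF K (fun t' => K t' t) u ≠ 0 := by
        rw [hb'KF, hexF]; exact ht
      simp only [ne_eq, ENNReal.tsum_eq_zero, not_forall, mul_eq_zero, not_or] at hinv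
      obtain ⟨u, ⟨w, hw1, hw2⟩, hu⟩ := hinv
      have hu1 : 1 ≤ u.1 := hA2 w.1 (hb0 w hw1) w.2 u hw2
      have hs1 : 1 ≤ s.1 := ha0 s (fun h => hs (by simpa [h] using hμa s))
      obtain ⟨s', hs', hF⟩ := access K hA4 μ hμ s u hs hs1 hu1
      rw [← hμ t, ENNReal.tsum_eq_zero] at h0
      exact hu (hF _ ((mul_eq_zero.1 (h0 s')).resolve_left hs'))
  have hG : ∀ G : ℤ × Fin m → ℝ≥0∞, ∑' s, b s * KF K G s = ∑' s, a s * G s := by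
    intro G
    rw [← hb'KF, hab]
  exact ⟨hG, fun F => by rw [← hG, hexF]⟩

lemma moms {m : ℕ} (K : ℤ × Fin m → PMF (ℤ × Fin m)) (ξ : Fin m → PMF ℤ)
    (hA1 : ∀ x : ℤ, 1 ≤ x → ∀ (i : Fin m) (y : ℤ), K (x, i) (x + y, i) = ξ i y)
    (hint : ∀ i, Summable fun y : ℤ => |(y : ℝ)| * (ξ i y).toReal)
    (hmean : ∀ i, ∑' y : ℤ, (y : ℝ) * (ξ i y).toReal = 0)
    (hsq : ∀ i, Summable fun y : ℤ => (y : ℝ) ^ 2 * (ξ i y).toReal)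
    (hvar : ∀ i, 0 < ∑' y : ℤ, (y : ℝ) ^ 2 * (ξ i y).toReal)
    (hrec : ∀ s, HF K (fun _ => 1) s = 1)
    (C : ℝ) (hC : 0 < C)
    (hA3 : ∀ x : ℤ, x ≤ 0 → ∀ i : Fin m,
      ∑' s' : ℤ × Fin m, (s'.1.toNat : ℝ≥0∞) * K (x, i) s' ≤
        ENNReal.ofReal (C * (1 + |(x : ℝ)|)))
    (a b : ℤ × Fin m → ℝ≥0∞) (ha1 : ∑' s, a s = 1)
    (ha0 : ∀ s, a s ≠ 0 → 1 ≤ s.1)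
    (hent : ∀ t, ∑' s, a s * HF K (fun t' => K t' t) s = a t)
    (hF : ∀ F : ℤ × Fin m → ℝ≥0∞, ∑' s, a s * HF K F s = ∑' s, b s * F s) :
    ∑' s, a s * ENNReal.ofReal |(s.1 : ℝ)| ≠ ⊤ ∧ ∑' s, b s * ENNReal.ofReal |(s.1 : ℝ)| ≠ ⊤ := by
  obtain ⟨B, hB, hb⟩ := HF_bound K ξ hA1 hint hmean hsq hvar (1 / (2 * C)) (by positivity)
  have hcast : ∀ x : ℤ, 1 ≤ x → ENNReal.ofReal (x : ℝ) = (x.toNat : ℝ≥0∞) := by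
    intro x hx
    rw [← ENNReal.ofReal_natCast]
    congr 1
    have : ((x.toNat : ℤ) : ℝ) = (x : ℝ) := by rw [Int.toNat_of_nonneg (by omega)]
    exact_mod_cast this.symm
  have hm := moment (fun s t => HF K (fun t' => K t' t) s) (fun s => (Q_sum K hrec s).le) a ha1 hent
    (fun s => s.1.toNat) (ENNReal.ofReal (C * (1 + B))) (by
      intro s hs
      have hs1 := ha0 s hs
      have hs2 : (1 : ℝ) ≤ s.1 := by exact_mod_cast hs1
      rw [Q_KF K (fun t => (t.1.toNat : ℝ≥0∞)) s]
      refine (HF_mono K (G := fun t => ENNReal.ofReal (C * (1 + |(t.1 : ℝ)|))) ?_ s).trans ((hb C hC.le s hs1).trans ?_)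
      · rintro ⟨x, i⟩ hx
        refine le_trans (le_of_eq ?_) (hA3 x hx i)
        unfold KF
        simp_rw [mul_comm]
      · have e : C * (1 + 1 / (2 * C) * (s.1 : ℝ) + B) = (s.1 : ℝ) / 2 + C * (1 + B) := by
          field_simp; ring
        rw [e, ENNReal.ofReal_add (by positivity) (by positivity), ENNReal.ofReal_div_of_pos (by norm_num), hcast _ hs1]
        simp)
  have hafin : ∑' s, a s * ENNReal.ofReal |(s.1 : ℝ)| ≠ ⊤ := by
    refine ne_top_of_le_ne_top (ENNReal.mul_ne_top (by simp) ENNReal.ofReal_ne_top) (le_trans (le_of_eq ?_) hm)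
    refine tsum_congr fun s => ?_
    by_cases hs : a s = 0
    · simp [hs]
    · have hs1 := ha0 s hs
      have hs2 : (1 : ℝ) ≤ s.1 := by exact_mod_cast hs1
      rw [abs_of_nonneg (by linarith), hcast _ hs1]
  refine ⟨hafin, ?_⟩
  rw [← hF]
  have hle : ∀ s, a s * HF K (fun t => ENNReal.ofReal |(t.1 : ℝ)|) s ≤
      ENNReal.ofReal (1 / (2 * C)) * (a s * ENNReal.ofReal |(s.1 : ℝ)|) + ENNReal.ofReal (1 + B) * a s := by
    intro s
    by_cases hs : a s = 0
    · simp [hs]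
    have hs1 := ha0 s hs
    have hs2 : (1 : ℝ) ≤ s.1 := by exact_mod_cast hs1
    have h1 : HF K (fun t => ENNReal.ofReal |(t.1 : ℝ)|) s ≤ ENNReal.ofReal (1 * (1 + 1 / (2 * C) * s.1 + B)) :=
      (HF_mono K (fun t _ => ENNReal.ofReal_le_ofReal (by linarith)) s).trans (hb 1 zero_le_one s hs1)
    have e : 1 * (1 + 1 / (2 * C) * (s.1 : ℝ) + B) = 1 / (2 * C) * |(s.1 : ℝ)| + (1 + B) := by
      rw [abs_of_nonneg (by linarith)]; ring
    rw [e, ENNReal.ofReal_add (by positivity) (by positivity), ENNReal.ofReal_mul (by positivity)] at h1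
    calc _ ≤ a s * (ENNReal.ofReal (1 / (2 * C)) * ENNReal.ofReal |(s.1 : ℝ)| + ENNReal.ofReal (1 + B)) := by gcongr
      _ = _ := by ring
  refine ne_top_of_le_ne_top ?_ (ENNReal.tsum_le_tsum hle)
  rw [ENNReal.tsum_add, ENNReal.tsum_mul_left, ENNReal.tsum_mul_left, ha1]
  exact ENNReal.add_ne_top.2 ⟨ENNReal.mul_ne_top ENNReal.ofReal_ne_top hafin, by simp⟩

/-- The ray does not change before the exit. -/
lemma HF_ray {m : ℕ} (K : ℤ × Fin m → PMF (ℤ × Fin m)) (ξ : Fin m → PMF ℤ)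
    (hA1 : ∀ x : ℤ, 1 ≤ x → ∀ (i : Fin m) (y : ℤ), K (x, i) (x + y, i) = ξ i y)
    (F : ℤ × Fin m → ℝ≥0∞) (s : ℤ × Fin m) (hF : ∀ t : ℤ × Fin m, t.2 = s.2 → F t = 0) :
    HF K F s = 0 := by
  refine HF_zero_of K F {t | t.2 = s.2} ?_ (fun t ht _ => hF t ht) s rfl
  rintro ⟨x, i⟩ hi hx u hu
  by_contra h
  simp only [Set.mem_ofPred_eq] at hi h
  exact hu (K_pos_eq K ξ hA1 x hx i u (by rw [hi]; exact h))

lemma ent_pos {m : ℕ} (K : ℤ × Fin m → PMF (ℤ × Fin m)) (ξ : Fin m → PMF ℤ)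
    (hA1 : ∀ x : ℤ, 1 ≤ x → ∀ (i : Fin m) (y : ℤ), K (x, i) (x + y, i) = ξ i y)
    (hrec : ∀ s, HF K (fun _ => 1) s = 1)
    (hA4 : ∀ s s' : ℤ × Fin m, 1 ≤ s.1 → 1 ≤ s'.1 → ∃ n : ℕ, iterK K n s s' ≠ 0)
    (a : ℤ × Fin m → ℝ≥0∞) (ha1 : ∑' s, a s = 1) (ha0 : ∀ s, a s ≠ 0 → 1 ≤ s.1)
    (hent : ∀ t, ∑' s, a s * HF K (fun t' => K t' t) s = a t) (k : Fin m) :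
    ∃ t : ℤ × Fin m, t.2 = k ∧ a t ≠ 0 := by
  classical
  obtain ⟨s, hs⟩ : ∃ s, a s ≠ 0 := by
    by_contra! h
    simp [h] at ha1
  obtain ⟨s', hs', hF⟩ := access K hA4 a hent s (1, k) hs (ha0 s hs) (by simp)
  refine ⟨s', ?_, hs'⟩
  by_contra hne
  have h1 := hF (fun t => if t.2 = k then 1 else 0) (HF_ray K ξ hA1 _ s' (fun t ht => by simp [ht, hne]))
  have h2 : HF K (fun t => if t.2 = k then 0 else 1) (1, k) = 0 :=
    HF_ray K ξ hA1 _ (1, k) (fun t ht => by simp [ht])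
  have h3 := HF_tsum K (fun _ : Bool => 1)
    (fun (c : Bool) (t : ℤ × Fin m) => if c then (if t.2 = k then (1 : ℝ≥0∞) else 0) else (if t.2 = k then 0 else 1)) (1, k)
  have h4 : (fun t : ℤ × Fin m => ∑' c : Bool, 1 * (if c then (if t.2 = k then (1 : ℝ≥0∞) else 0) else (if t.2 = k then 0 else 1))) = fun _ => 1 := by
    funext t
    rw [tsum_fintype]
    simp
    split_ifs <;> simp
  rw [h4, hrec, tsum_fintype] at h3
  simp [h1, h2] at h3

/-- The weights `p_k` of the limiting Walsh Brownian motion: the three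
expressions in (3.17) coincide, each `p_k` is positive, and they sum to 1. -/
theorem stmt_5
    (m : ℕ) (hm : 1 ≤ m)
    (K : ℤ × Fin m → PMF (ℤ × Fin m))
    (P : ℤ × Fin m → Measure (ℕ → ℤ × Fin m))
    (hprob : ∀ s, IsProbabilityMeasure (P s))
    -- `P s` is the law of the Markov chain with kernel `K` started at `s`
    (hcyl : ∀ (s : ℤ × Fin m) (n : ℕ) (path : ℕ → ℤ × Fin m),
      P s {ω | ∀ k ≤ n, ω k = path k} =
        (if path 0 = s then 1 else 0) *
          ∏ k ∈ Finset.range n, K (path k) (path (k + 1)))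
    -- (A1): on `ℕ × {i}` the radius jumps like a centered square-integrable
    -- 1-arithmetic random walk with step distribution `ξ i`, variance `(v i)²`
    (ξ : Fin m → PMF ℤ) (v : Fin m → ℝ) (hv : ∀ i, 0 < v i)
    (hA1 : ∀ x : ℤ, 1 ≤ x → ∀ (i : Fin m) (y : ℤ), K (x, i) (x + y, i) = ξ i y)
    (hint : ∀ i, Summable fun y : ℤ => |(y : ℝ)| * (ξ i y).toReal)
    (hmean : ∀ i, ∑' y : ℤ, (y : ℝ) * (ξ i y).toReal = 0)
    (hsq : ∀ i, Summable fun y : ℤ => (y : ℝ) ^ 2 * (ξ i y).toReal)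
    (hvar : ∀ i, (v i) ^ 2 = ∑' y : ℤ, (y : ℝ) ^ 2 * (ξ i y).toReal)
    (harith : ∀ i, ∀ n : ℕ, 1 ≤ n →
      (∀ y : ℤ, ξ i y ≠ 0 → (n : ℤ) ∣ y) → n = 1)
    -- (A2): from a non-positive radius the chain jumps to `ℕ × {1,…,m}` a.s.
    (hA2 : ∀ x : ℤ, x ≤ 0 → ∀ i : Fin m, ∀ s' : ℤ × Fin m,
      K (x, i) s' ≠ 0 → 1 ≤ s'.1)
    -- (A3): `E[R(1) | 𝒳(0) = (x,i)] ≤ C (1 + |x|)` for `x ≤ 0`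
    (C : ℝ) (hC : 0 < C)
    (hA3 : ∀ x : ℤ, x ≤ 0 → ∀ i : Fin m,
      ∑' s' : ℤ × Fin m, (s'.1.toNat : ℝ≥0∞) * K (x, i) s' ≤
        ENNReal.ofReal (C * (1 + |(x : ℝ)|)))
    -- (A4): the states `ℕ × {1,…,m}` communicate
    (hA4 : ∀ s s' : ℤ × Fin m, 1 ≤ s.1 → 1 ≤ s'.1 → ∃ n : ℕ, iterK K n s s' ≠ 0)
    (πexit πent : Measure (ℤ × Fin m))
    (hπexit : ExitStationary P πexit) (hπent : EntranceStationary P πent)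
    (p : Fin m → ℝ)
    -- `p_k := E_{π_ent}[(R(0) − R(σ₁)) v_k⁻¹ 1_{l(0)=k}] /
    --         E_{π_ent}[(R(0) − R(σ₁)) v_{l(0)}⁻¹]`
    (hp : ∀ k : Fin m, p k =
      (∑' s : ℤ × Fin m, (πent {s}).toReal *
        ∫ ω, (if (ω 0).2 = k then
          (((ω 0).1 - (ω (sigmaT 0 ω)).1 : ℤ) : ℝ) / v k else 0) ∂(P s)) /
      (∑' s : ℤ × Fin m, (πent {s}).toReal *
        ∫ ω, (((ω 0).1 - (ω (sigmaT 0 ω)).1 : ℤ) : ℝ) / v (ω 0).2 ∂(P s))) :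
    (∀ k : Fin m, p k =
      ((∑' s : ℤ × Fin m, (if s.2 = k then (s.1 : ℝ) / v k else 0) *
          (πent {s}).toReal) -
        (∑' s : ℤ × Fin m, (if s.2 = k then (s.1 : ℝ) / v k else 0) *
          (πexit {s}).toReal)) /
      ((∑' s : ℤ × Fin m, ((s.1 : ℝ) / v s.2) * (πent {s}).toReal) -
        (∑' s : ℤ × Fin m, ((s.1 : ℝ) / v s.2) * (πexit {s}).toReal))) ∧
    (∀ k : Fin m, p k =
      (∑' s : ℤ × Fin m, (πexit {s}).toReal *
        ∫ ω, ((if (ω 1).2 = k then ((ω 1).1 : ℝ) / v k else 0) -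
          (if (ω 0).2 = k then ((ω 0).1 : ℝ) / v k else 0)) ∂(P s)) /
      (∑' s : ℤ × Fin m, (πexit {s}).toReal *
        ∫ ω, (((ω 1).1 : ℝ) / v (ω 1).2 - ((ω 0).1 : ℝ) / v (ω 0).2) ∂(P s))) ∧
    (∀ k : Fin m, 0 < p k) ∧
    (∑ k : Fin m, p k) = 1 := by
  have hprob1 := hprob
  have hvar' : ∀ i, 0 < ∑' y : ℤ, (y : ℝ) ^ 2 * (ξ i y).toReal := fun i => by
    rw [← hvar i]; exact pow_pos (hv i) 2
  have hrec := HF_rec K ξ hA1 hint hmean hsq hvar'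
  obtain ⟨hπe1, hπe2, hπe3⟩ := hπent
  obtain ⟨hπx1, hπx2, hπx3⟩ := hπexit
  have ha1 := tsum_measure_singleton πent
  have hb1 := tsum_measure_singleton πexit
  have ha0 : ∀ s : ℤ × Fin m, πent {s} ≠ 0 → 1 ≤ s.1 := by
    intro s hs
    by_contra h
    exact hs (measure_mono_null (Set.singleton_subset_iff.2 (show s.1 ≤ 0 by omega)) hπe2)
  have hb0 : ∀ s : ℤ × Fin m, πexit {s} ≠ 0 → s.1 ≤ 0 := by
    intro s hs
    by_contra h
    exact hs (measure_mono_null (Set.singleton_subset_iff.2 (show 1 ≤ s.1 by omega)) hπx2)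
  have hent : ∀ t, ∑' s, πent {s} * HF K (fun t' => K t' t) s = πent {t} := by
    intro t
    rw [← hπe3 {t}]
    refine tsum_congr fun s => ?_
    rw [P_ent K P hprob hcyl hrec]
    congr 2
    funext u
    exact (KF_indicator K t u).symm
  have hexit : ∀ t, ∑' s, πexit {s} * KF K (HF K (Set.indicator {t} 1)) s = πexit {t} := by
    intro t
    rw [← hπx3 {t}]
    refine tsum_congr fun s => ?_
    by_cases hs : πexit {s} = 0
    · simp [hs]
    · rw [P_exit2 K P hprob hcyl hrec s (hb0 s hs)]
  obtain ⟨hKF, hHF⟩ := core K hrec hA2 hA4 (fun s => πent {s}) (fun s => πexit {s}) ha1 hb1 ha0 hb0 hent hexit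
  obtain ⟨hma, hmb⟩ := moms K ξ hA1 hint hmean hsq hvar' hrec C hC hA3 (fun s => πent {s})
    (fun s => πexit {s}) ha1 ha0 hent hHF
  obtain ⟨c, hc⟩ : ∃ c, c = ∑ i, (v i)⁻¹ := ⟨_, rfl⟩
  have hc0 : 0 ≤ c := by rw [hc]; exact Finset.sum_nonneg fun i _ => (inv_pos.2 (hv i)).le
  have hci : ∀ i, (v i)⁻¹ ≤ c := fun i => by
    rw [hc]
    exact Finset.single_le_sum (f := fun i => (v i)⁻¹) (fun i _ => (inv_pos.2 (hv i)).le) (Finset.mem_univ i)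
  obtain ⟨Gt, hGt⟩ : ∃ Gt : ℤ × Fin m → ℝ, Gt = fun s => (s.1 : ℝ) / v s.2 := ⟨_, rfl⟩
  obtain ⟨G, hG⟩ : ∃ G : Fin m → ℤ × Fin m → ℝ, G = fun k s => if s.2 = k then (s.1 : ℝ) / v k else 0 := ⟨_, rfl⟩
  have hGtb : ∀ s, |Gt s| ≤ c * |(s.1 : ℝ)| := by
    intro s
    rw [hGt]
    change |(s.1 : ℝ) / v s.2| ≤ c * |(s.1 : ℝ)|
    rw [abs_div, abs_of_pos (hv s.2), div_eq_mul_inv, mul_comm]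
    exact mul_le_mul_of_nonneg_right (hci _) (abs_nonneg _)
  have hGb : ∀ k s, |G k s| ≤ c * |(s.1 : ℝ)| := by
    intro k s
    by_cases h : s.2 = k
    · have := hGtb s
      rw [hGt] at this
      rw [hG]
      simp only [h, if_true] at this ⊢
      exact this
    · rw [hG]
      simp only [h, if_false, abs_zero]
      positivity
  have hsum : ∀ s, ∑ k, G k s = Gt s := by
    intro s; simp [hG, hGt]
  have hta := G_int πent hma Gt c hc0 hGtb
  have htb := G_int πexit hmb Gt c hc0 hGtb
  have hka := fun k => G_int πent hma (G k) c hc0 (hGb k)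
  have hkb := fun k => G_int πexit hmb (G k) c hc0 (hGb k)
  have hm0 : Measurable fun ω : ℕ → ℤ × Fin m => ω 0 := measurable_pi_apply 0
  have hm1 : Measurable fun ω : ℕ → ℤ × Fin m => ω 1 := measurable_pi_apply 1
  have hray : ∀ s, ∀ᵐ ω ∂P s, (ω (sigmaT 0 ω)).2 = s.2 := by
    classical
    intro s
    have h1 := lintegral_at_exit K P hprob hcyl hrec s (fun t => if t.2 = s.2 then 0 else 1)
    rw [HF_ray K ξ hA1 _ s (fun t ht => by simp [ht])] at h1
    have h2 := (lintegral_eq_zero_iff ((measurable_of_countable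
      (fun t : ℤ × Fin m => if t.2 = s.2 then (0 : ℝ≥0∞) else 1)).comp (measurable_at_sigma 0))).1 h1
    filter_upwards [h2] with ω hω
    by_contra h
    simp [h] at hω
  have X1 : ∀ (H : ℤ × Fin m → ℝ) (I : (ℕ → ℤ × Fin m) → ℝ), Integrable H πent → Integrable H πexit →
      (∀ s, ∀ᵐ ω ∂P s, I ω = H (ω 0) - H (ω (sigmaT 0 ω))) →
      ∑' s, (πent {s}).toReal * ∫ ω, I ω ∂P s =
        ∑' s, H s * (πent {s}).toReal - ∑' s, H s * (πexit {s}).toReal := by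
    intro H I h1 h2 hI
    refine X_eq P hprob πent πent πexit (fun ω => ω 0) (fun ω => ω (sigmaT 0 ω)) hm0
      (measurable_at_sigma 0) ?_ ?_ H h1 h2 I (fun s _ => hI s)
    · intro F
      simp_rw [P_coord0 K P hprob hcyl]
    · intro F
      simp_rw [lintegral_at_exit K P hprob hcyl hrec]
      exact hHF F
  have X3 : ∀ (H : ℤ × Fin m → ℝ), Integrable H πent → Integrable H πexit →
      ∑' s, (πexit {s}).toReal * ∫ ω, (H (ω 1) - H (ω 0)) ∂P s =
        ∑' s, H s * (πent {s}).toReal - ∑' s, H s * (πexit {s}).toReal := by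
    intro H h1 h2
    refine X_eq P hprob πexit πent πexit (fun ω => ω 1) (fun ω => ω 0) hm1 hm0
      ?_ ?_ H h1 h2 _ (fun s _ => Filter.Eventually.of_forall fun ω => rfl)
    · intro F
      simp_rw [P_coord1 K P hprob hcyl]
      exact hKF F
    · intro F
      simp_rw [P_coord0 K P hprob hcyl]
  have e1 : ∀ k, ∑' s : ℤ × Fin m, (πent {s}).toReal *
        ∫ ω, (if (ω 0).2 = k then
          (((ω 0).1 - (ω (sigmaT 0 ω)).1 : ℤ) : ℝ) / v k else 0) ∂(P s) =
        ∑' s, G k s * (πent {s}).toReal - ∑' s, G k s * (πexit {s}).toReal := by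
    intro k
    refine X1 (G k) _ (hka k).1 (hkb k).1 fun s => ?_
    filter_upwards [hray s, P_start K P hprob hcyl s] with ω h1 h2
    rw [hG]
    simp only [h1, h2]
    split_ifs
    · push_cast; ring
    · simp
  have e2 : ∑' s : ℤ × Fin m, (πent {s}).toReal *
        ∫ ω, (((ω 0).1 - (ω (sigmaT 0 ω)).1 : ℤ) : ℝ) / v (ω 0).2 ∂(P s) =
        ∑' s, Gt s * (πent {s}).toReal - ∑' s, Gt s * (πexit {s}).toReal := by
    refine X1 Gt _ hta.1 htb.1 fun s => ?_
    filter_upwards [hray s, P_start K P hprob hcyl s] with ω h1 h2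
    rw [hGt]
    simp only [h1, h2]
    push_cast; ring
  have hpk : ∀ k, p k = (∑' s, G k s * (πent {s}).toReal - ∑' s, G k s * (πexit {s}).toReal) /
      (∑' s, Gt s * (πent {s}).toReal - ∑' s, Gt s * (πexit {s}).toReal) := by
    intro k
    rw [hp k, e1 k, e2]
  have hNpos : ∀ k, 0 < ∑' s, G k s * (πent {s}).toReal - ∑' s, G k s * (πexit {s}).toReal := by
    intro k
    obtain ⟨t, htk, hta⟩ := ent_pos K ξ hA1 hrec hA4 (fun s => πent {s}) ha1 ha0 hent k
    have hnn : ∀ s, 0 ≤ G k s * (πent {s}).toReal := by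
      intro s
      by_cases hs : πent {s} = 0
      · simp [hs]
      · have hs2 : (1 : ℝ) ≤ s.1 := by exact_mod_cast ha0 s hs
        have := hv k
        rw [hG]
        simp only
        split_ifs
        · positivity
        · simp
    have h1 : 0 < ∑' s, G k s * (πent {s}).toReal := by
      refine (hka k).2.tsum_pos hnn t ?_
      have hs2 : (1 : ℝ) ≤ t.1 := by exact_mod_cast ha0 t hta
      have := hv k
      have h3 : 0 < (πent {t}).toReal := ENNReal.toReal_pos hta (measure_ne_top _ _)
      rw [hG]
      simp only [htk, if_true]
      positivity
    have h2 : ∑' s, G k s * (πexit {s}).toReal ≤ 0 := by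
      refine tsum_nonpos fun s => ?_
      by_cases hs : πexit {s} = 0
      · simp [hs]
      · have hs2 : (s.1 : ℝ) ≤ 0 := by exact_mod_cast hb0 s hs
        refine mul_nonpos_of_nonpos_of_nonneg ?_ ENNReal.toReal_nonneg
        rw [hG]
        simp only
        split_ifs
        · exact div_nonpos_of_nonpos_of_nonneg hs2 (hv k).le
        · exact le_rfl
    linarith
  have hD : ∑ k, (∑' s, G k s * (πent {s}).toReal - ∑' s, G k s * (πexit {s}).toReal) =
      ∑' s, Gt s * (πent {s}).toReal - ∑' s, Gt s * (πexit {s}).toReal := by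
    rw [Finset.sum_sub_distrib, ← Summable.tsum_finsetSum (fun k _ => (hka k).2),
      ← Summable.tsum_finsetSum (fun k _ => (hkb k).2)]
    simp_rw [← Finset.sum_mul, hsum]
  have hDpos : 0 < ∑' s, Gt s * (πent {s}).toReal - ∑' s, Gt s * (πexit {s}).toReal := by
    rw [← hD]
    exact Finset.sum_pos (fun k _ => hNpos k) ⟨⟨0, hm⟩, Finset.mem_univ _⟩
  refine ⟨fun k => ?_, fun k => ?_, fun k => ?_, ?_⟩
  · rw [hpk k, hG, hGt]
  · rw [hpk k, ← X3 _ (hka k).1 (hkb k).1, ← X3 _ hta.1 htb.1, hG, hGt]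
  · rw [hpk k]; exact div_pos (hNpos k) hDpos
  · simp_rw [hpk]
    rw [← Finset.sum_div, hD, div_self hDpos.ne']
end

section
/- If max_{|x|≤d} E[|X(1)| | X(0) = x] < ∞ (condition B3′), then E[|X(τ̃₀)| | X(0) = x] < ∞ for every x with |x| ≤ d (condition B3). In other words, under (B2), condition B3′ implies condition B3. -/
open MeasureTheory Filter
open scoped ENNReal

/-- `τ̃₀ = inf {k ≥ 0 : |X(k)| > d}`, the first exit time from the
membrane `{-d, …, d}`, along a trajectory `ω`. -/
noncomputable def firstExit (d : ℤ) (ω : ℕ → ℤ) : ℕ :=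
  sInf {k : ℕ | d < |ω k|}

/-- The event that the chain stays in the membrane up to time `n`. -/
def stayS (d : ℤ) (n : ℕ) : Set (ℕ → ℤ) := {ω | ∀ k ≤ n, |ω k| ≤ d}

lemma meas_coord (k : ℕ) (s : Set ℤ) : MeasurableSet {ω : ℕ → ℤ | ω k ∈ s} :=
  (measurable_pi_apply k) (MeasurableSet.of_discrete (s := s))

lemma meas_stayS (d : ℤ) (n : ℕ) : MeasurableSet (stayS d n) := by
  have : stayS d n = ⋂ k, ⋂ (_ : k ≤ n), {ω | ω k ∈ {z : ℤ | |z| ≤ d}} := by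
    ext ω; simp [stayS]
  rw [this]
  exact MeasurableSet.iInter fun k => MeasurableSet.iInter fun _ => meas_coord k _

lemma meas_cyl (n : ℕ) (p : ℕ → ℤ) : MeasurableSet {ω : ℕ → ℤ | ∀ k ≤ n, ω k = p k} := by
  have : {ω : ℕ → ℤ | ∀ k ≤ n, ω k = p k} = ⋂ k, ⋂ (_ : k ≤ n), {ω | ω k ∈ ({p k} : Set ℤ)} := by
    ext ω; simp
  rw [this]
  exact MeasurableSet.iInter fun k => MeasurableSet.iInter fun _ => meas_coord k _

/-- extension of a finite path by a constant -/
def extP (n : ℕ) (z : ℤ) (p : Fin (n + 1) → ℤ) : ℕ → ℤ :=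
  fun k => if h : k < n + 1 then p ⟨k, h⟩ else z

lemma decomp (μ : Measure (ℕ → ℤ)) (n : ℕ) (z : ℤ) (E : Set (ℕ → ℤ)) :
    μ E = ∑' p : Fin (n + 1) → ℤ, μ (E ∩ {ω | ∀ k ≤ n, ω k = extP n z p k}) := by
  have hpre : ∀ p : Fin (n + 1) → ℤ, {ω : ℕ → ℤ | ∀ k ≤ n, ω k = extP n z p k} =
      (fun (ω : ℕ → ℤ) (i : Fin (n + 1)) => ω i) ⁻¹' {p} := by
    intro p
    ext ω
    simp only [Set.mem_ofPred_eq, Set.mem_preimage, Set.mem_singleton_iff, funext_iff, extP]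
    constructor
    · intro h i
      have := h i (by omega)
      rw [dif_pos i.isLt] at this
      exact this
    · intro h k hk
      have := h ⟨k, by omega⟩
      simp [this, Nat.lt_succ_of_le hk]
  have h1 := tsum_measure_preimage_singleton (μ := μ.restrict E) (s := Set.univ)
    (Set.to_countable _) (f := fun (ω : ℕ → ℤ) (i : Fin (n + 1)) => ω i)
    (fun p _ => by rw [← hpre]; exact meas_cyl n _)
  rw [Set.preimage_univ, Measure.restrict_apply_univ] at h1
  rw [← h1, tsum_univ (f := fun p => (μ.restrict E)
    ((fun (ω : ℕ → ℤ) (i : Fin (n + 1)) => ω i) ⁻¹' {p}))]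
  refine tsum_congr fun p => ?_
  rw [← hpre, Measure.restrict_apply (meas_cyl n _), Set.inter_comm]

lemma markov_step (d : ℤ) (K : ℤ → PMF ℤ) (μ : Measure (ℕ → ℤ)) (x : ℤ)
    (hcyl : ∀ (n : ℕ) (path : ℕ → ℤ),
      μ {ω | ∀ k ≤ n, ω k = path k} =
        (if path 0 = x then 1 else 0) *
          ∏ k ∈ Finset.range n, K (path k) (path (k + 1)))
    (n : ℕ) (y z : ℤ) :
    μ (stayS d n ∩ {ω | ω n = y} ∩ {ω | ω (n + 1) = z}) =
      μ (stayS d n ∩ {ω | ω n = y}) * K y z := by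
  rw [decomp μ n z, decomp μ n z (stayS d n ∩ {ω | ω n = y}), ← ENNReal.tsum_mul_right]
  refine tsum_congr fun p => ?_
  set q := extP n z p with hq
  have hqz : q (n + 1) = z := by simp [hq, extP]
  by_cases hp : (∀ k ≤ n, |q k| ≤ d) ∧ q n = y
  · have e1 : stayS d n ∩ {ω | ω n = y} ∩ {ω | ω (n + 1) = z} ∩ {ω | ∀ k ≤ n, ω k = q k}
        = {ω | ∀ k ≤ n + 1, ω k = q k} := by
      ext ω
      simp only [stayS, Set.mem_inter_iff, Set.mem_ofPred_eq]
      constructor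
      · rintro ⟨⟨-, h2⟩, h3⟩ k hk
        rcases Nat.lt_or_ge n k with h | h
        · have : k = n + 1 := by omega
          rw [this, h2, hqz]
        · exact h3 k h
      · intro h
        refine ⟨⟨⟨fun k hk => ?_, ?_⟩, ?_⟩, fun k hk => h k (by omega)⟩
        · rw [h k (by omega)]; exact hp.1 k hk
        · rw [h n (by omega)]; exact hp.2
        · rw [h (n + 1) le_rfl, hqz]
    have e2 : stayS d n ∩ {ω | ω n = y} ∩ {ω | ∀ k ≤ n, ω k = q k}
        = {ω | ∀ k ≤ n, ω k = q k} := by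
      apply Set.inter_eq_right.2
      intro ω h
      exact ⟨fun k hk => by rw [h k hk]; exact hp.1 k hk, (h n le_rfl).trans hp.2⟩
    rw [e1, e2, hcyl, hcyl, Finset.prod_range_succ, hqz, hp.2, mul_assoc]
  · have e2 : stayS d n ∩ {ω | ω n = y} ∩ {ω | ∀ k ≤ n, ω k = q k} = ∅ := by
      apply Set.eq_empty_of_forall_notMem
      rintro ω ⟨⟨h1, h2⟩, h3⟩
      exact hp ⟨fun k hk => by rw [← h3 k hk]; exact h1 k hk, (h3 n le_rfl).symm.trans h2⟩
    have e1 : stayS d n ∩ {ω | ω n = y} ∩ {ω | ω (n + 1) = z} ∩ {ω | ∀ k ≤ n, ω k = q k}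
        = ∅ := by
      apply Set.eq_empty_of_forall_notMem
      rintro ω ⟨⟨h1, h2⟩, h3⟩
      have : ω ∈ (∅ : Set (ℕ → ℤ)) := e2 ▸ ⟨h1, h3⟩
      exact this
    rw [e1, e2]; simp

lemma meas_A (d : ℤ) (n : ℕ) (y : ℤ) : MeasurableSet (stayS d n ∩ {ω | ω n = y}) :=
  (meas_stayS d n).inter (meas_coord n {y})

lemma stay_union (d : ℤ) (n : ℕ) :
    stayS d n = ⋃ y : Finset.Icc (-d) d, stayS d n ∩ {ω | ω n = (y : ℤ)} := by
  ext ω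
  simp only [Set.mem_iUnion, Set.mem_inter_iff, Set.mem_ofPred_eq]
  constructor
  · intro h
    exact ⟨⟨ω n, Finset.mem_Icc.2 (abs_le.1 (h n le_rfl))⟩, h, rfl⟩
  · rintro ⟨y, h, -⟩
    exact h

lemma stay_sum (d : ℤ) (μ : Measure (ℕ → ℤ)) (n : ℕ) :
    μ (stayS d n) = ∑ y : Finset.Icc (-d) d, μ (stayS d n ∩ {ω | ω n = (y : ℤ)}) := by
  conv_lhs => rw [stay_union d n]
  rw [measure_iUnion (f := fun y : Finset.Icc (-d) d => stayS d n ∩ {ω | ω n = (y : ℤ)}) _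
    (fun y => meas_A d n y), tsum_fintype]
  intro a b hab
  refine Set.disjoint_left.2 ?_
  rintro ω ⟨_, h1⟩ ⟨_, h2⟩
  exact hab (Subtype.ext (h1.symm.trans h2))

/-- transition matrix killed outside of the membrane -/
noncomputable def TM (d : ℤ) (K : ℤ → PMF ℤ) :
    Matrix (Finset.Icc (-d) d) (Finset.Icc (-d) d) ℝ≥0∞ :=
  Matrix.of fun y z => K y z

lemma stay_pow (d : ℤ) (K : ℤ → PMF ℤ) (μ : Measure (ℕ → ℤ)) (x : Finset.Icc (-d) d)
    (hcyl : ∀ (n : ℕ) (path : ℕ → ℤ),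
      μ {ω | ∀ k ≤ n, ω k = path k} =
        (if path 0 = (x : ℤ) then 1 else 0) *
          ∏ k ∈ Finset.range n, K (path k) (path (k + 1)))
    (n : ℕ) (z : Finset.Icc (-d) d) :
    μ (stayS d n ∩ {ω | ω n = (z : ℤ)}) = (TM d K ^ n) x z := by
  induction n generalizing z with
  | zero =>
    have : stayS d 0 ∩ {ω | ω 0 = (z : ℤ)} = {ω | ∀ k ≤ 0, ω k = (fun _ => (z : ℤ)) k} := by
      ext ω
      simp only [stayS, Set.mem_inter_iff, Set.mem_ofPred_eq, Nat.le_zero, forall_eq]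
      constructor
      · exact fun h => h.2
      · intro h
        exact ⟨by rw [h]; exact abs_le.2 (Finset.mem_Icc.1 z.2), h⟩
    rw [this, hcyl]
    rw [Finset.range_zero, Finset.prod_empty, mul_one, pow_zero, Matrix.one_apply]
    by_cases hxz : x = z
    · simp [hxz]
    · rw [if_neg hxz, if_neg fun h => hxz (Subtype.ext h.symm)]
  | succ n ih =>
    rw [pow_succ, Matrix.mul_apply]
    have : stayS d (n + 1) ∩ {ω | ω (n + 1) = (z : ℤ)} = ⋃ y : Finset.Icc (-d) d,
        stayS d n ∩ {ω | ω n = (y : ℤ)} ∩ {ω | ω (n + 1) = (z : ℤ)} := by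
      rw [← Set.iUnion_inter, ← stay_union]
      ext ω
      simp only [stayS, Set.mem_inter_iff, Set.mem_ofPred_eq]
      constructor
      · exact fun h => ⟨fun k hk => h.1 k (by omega), h.2⟩
      · rintro ⟨h1, h2⟩
        refine ⟨fun k hk => ?_, h2⟩
        rcases Nat.lt_or_ge n k with h | h
        · have : k = n + 1 := by omega
          rw [this, h2]; exact abs_le.2 (Finset.mem_Icc.1 z.2)
        · exact h1 k h
    rw [this, measure_iUnion (f := fun y : Finset.Icc (-d) d =>
      stayS d n ∩ {ω | ω n = (y : ℤ)} ∩ {ω | ω (n + 1) = (z : ℤ)}) _ (fun y => (meas_A d n y).inter (meas_coord (n + 1) {(z : ℤ)})),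
      tsum_fintype]
    · refine Finset.sum_congr rfl fun y _ => ?_
      rw [markov_step d K μ x hcyl, ih]
      rfl
    · intro a b hab
      refine Set.disjoint_left.2 ?_
      rintro ω ⟨⟨_, h1⟩, _⟩ ⟨⟨_, h2⟩, _⟩
      exact hab (Subtype.ext (h1.symm.trans h2))

lemma sum_finite (a : ℕ → ℝ≥0∞) (N : ℕ) (h1 : ∀ n, a n ≤ 1)
    (h2 : ∀ n, a (N + n) ≤ 2⁻¹ * a n) : ∑' n, a n ≠ ⊤ := by
  have key : ∀ m, ∑ n ∈ Finset.range m, a n ≤ 2 * N := by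
    intro m
    have e1 : ∑ n ∈ Finset.range m, a n ≤ N + 2⁻¹ * ∑ n ∈ Finset.range m, a n := by
      calc ∑ n ∈ Finset.range m, a n ≤ ∑ n ∈ Finset.range (N + m), a n :=
            Finset.sum_le_sum_of_subset (Finset.range_mono (by omega))
        _ = ∑ n ∈ Finset.range N, a n + ∑ n ∈ Finset.range m, a (N + n) :=
            Finset.sum_range_add _ _ _
        _ ≤ N + 2⁻¹ * ∑ n ∈ Finset.range m, a n := by
            gcongr
            · calc ∑ n ∈ Finset.range N, a n ≤ ∑ n ∈ Finset.range N, 1 :=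
                    Finset.sum_le_sum fun n _ => h1 n
                _ = N := by simp
            · rw [Finset.mul_sum]
              exact Finset.sum_le_sum fun n _ => h2 n
    have hfin : ∑ n ∈ Finset.range m, a n ≠ ⊤ :=
      ENNReal.sum_ne_top.2 fun n _ => ne_top_of_le_ne_top ENNReal.one_ne_top (h1 n)
    generalize ∑ n ∈ Finset.range m, a n = X at *
    lift X to NNReal using hfin
    have e2 : X ≤ N + 2⁻¹ * X := by
      have h : ((2 : ℝ≥0∞)⁻¹) = ((2⁻¹ : NNReal) : ℝ≥0∞) := by
        rw [ENNReal.coe_inv two_ne_zero]; rfl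
      rw [h] at e1
      exact_mod_cast e1
    have e3 : X ≤ 2 * N := by
      rw [← NNReal.coe_le_coe] at e2 ⊢
      push_cast at e2 ⊢
      linarith
    exact_mod_cast e3
  refine ne_top_of_le_ne_top (b := 2 * (N : ℝ≥0∞)) (by finiteness) ?_
  exact ENNReal.tsum_le_of_sum_range_le key

lemma step_int (d : ℤ) (K : ℤ → PMF ℤ) (μ : Measure (ℕ → ℤ)) (x : ℤ)
    (hcyl : ∀ (n : ℕ) (path : ℕ → ℤ),
      μ {ω | ∀ k ≤ n, ω k = path k} =
        (if path 0 = x then 1 else 0) *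
          ∏ k ∈ Finset.range n, K (path k) (path (k + 1)))
    (n : ℕ) (y : ℤ) :
    ∫⁻ ω in stayS d n ∩ {ω | ω n = y}, ((ω (n + 1)).natAbs : ℝ≥0∞) ∂μ =
      μ (stayS d n ∩ {ω | ω n = y}) * ∑' z : ℤ, (z.natAbs : ℝ≥0∞) * K y z := by
  have h := lintegral_map (μ := μ.restrict (stayS d n ∩ {ω | ω n = y}))
    (f := fun z : ℤ => (z.natAbs : ℝ≥0∞)) (g := fun ω : ℕ → ℤ => ω (n + 1))
    (Measurable.of_discrete) (measurable_pi_apply _)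
  rw [← h, lintegral_countable', ← ENNReal.tsum_mul_left]
  refine tsum_congr fun z => ?_
  have hme : Measurable fun ω : ℕ → ℤ => ω (n + 1) := measurable_pi_apply (n + 1)
  rw [Measure.map_apply hme (measurableSet_singleton z),
    Measure.restrict_apply (hme (measurableSet_singleton z)),
    Set.inter_comm]
  have := markov_step d K μ x hcyl n y z
  have e : (fun ω : ℕ → ℤ => ω (n + 1)) ⁻¹' {z} = {ω | ω (n + 1) = z} := rfl
  rw [e, this]
  ring

/-- Under (B1) and (B2), condition (B3′) `max_{|x|≤d} E[|X(1)| | X(0)=x] < ∞`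
implies condition (B3) `E[|X(τ̃₀)| | X(0)=x] < ∞` for every `|x| ≤ d`.

The Markov chain `X` on `ℤ` is encoded by its one-step transition kernel
`K : ℤ → PMF ℤ` together with the family `P x` of laws of the whole
trajectory started at `x`, determined on cylinder sets by `K`. -/
theorem stmt_10 (d : ℤ) (hd : 0 ≤ d)
    (K : ℤ → PMF ℤ) (P : ℤ → Measure (ℕ → ℤ))
    (hprob : ∀ x, IsProbabilityMeasure (P x))
    -- `P x` is the law of the Markov chain with kernel `K` started at `x`
    (hcyl : ∀ (x : ℤ) (n : ℕ) (path : ℕ → ℤ),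
      P x {ω | ∀ k ≤ n, ω k = path k} =
        (if path 0 = x then 1 else 0) *
          ∏ k ∈ Finset.range n, K (path k) (path (k + 1)))
    -- (B1): homogeneous centered square-integrable 1-arithmetic jumps off the membrane
    (ξp ξm : PMF ℤ)
    (hB1p : ∀ x : ℤ, d < x → ∀ y : ℤ, K x (x + y) = ξp y)
    (hB1m : ∀ x : ℤ, x < -d → ∀ y : ℤ, K x (x + y) = ξm y)
    (hintp : Summable fun y : ℤ => |(y : ℝ)| * (ξp y).toReal)
    (hintm : Summable fun y : ℤ => |(y : ℝ)| * (ξm y).toReal)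
    (hmeanp : ∑' y : ℤ, (y : ℝ) * (ξp y).toReal = 0)
    (hmeanm : ∑' y : ℤ, (y : ℝ) * (ξm y).toReal = 0)
    (hsqp : Summable fun y : ℤ => (y : ℝ) ^ 2 * (ξp y).toReal)
    (hsqm : Summable fun y : ℤ => (y : ℝ) ^ 2 * (ξm y).toReal)
    (hvarp : 0 < ∑' y : ℤ, (y : ℝ) ^ 2 * (ξp y).toReal)
    (hvarm : 0 < ∑' y : ℤ, (y : ℝ) ^ 2 * (ξm y).toReal)
    (harithp : ∀ n : ℕ, 1 ≤ n → (∀ y : ℤ, ξp y ≠ 0 → (n : ℤ) ∣ y) → n = 1)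
    (harithm : ∀ n : ℕ, 1 ≤ n → (∀ y : ℤ, ξm y ≠ 0 → (n : ℤ) ∣ y) → n = 1)
    -- (B2): the chain exits the membrane with probability one
    (hB2 : ∀ x : ℤ, |x| ≤ d → P x {ω | ∃ k, d < |ω k|} = 1)
    -- (B3′): integrable one-step jumps from the membrane
    (hB3' : ∀ x : ℤ, |x| ≤ d → ∫⁻ ω, ((ω 1).natAbs : ℝ≥0∞) ∂(P x) ≠ ⊤) :
    -- (B3): integrable exit values from the membrane
    ∀ x : ℤ, |x| ≤ d → ∫⁻ ω, ((ω (firstExit d ω)).natAbs : ℝ≥0∞) ∂(P x) ≠ ⊤ := by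
  intro x hx
  have hmem : ∀ y : Finset.Icc (-d) d, |(y : ℤ)| ≤ d := fun y => abs_le.2 (Finset.mem_Icc.1 y.2)
  -- the start is deterministic
  have hstart : ∀ y, ∀ᵐ ω ∂(P y), ω 0 = y := by
    intro y
    have := hcyl y 0 (fun _ => y)
    simp at this
    exact (mem_ae_iff_prob_eq_one (meas_coord 0 {y})).2 this
  -- one step expectations
  have hr : ∀ y : Finset.Icc (-d) d, ∑' z : ℤ, (z.natAbs : ℝ≥0∞) * K y z ≠ ⊤ := by
    intro y
    have h1 := step_int d K (P y) y (hcyl y) 0 y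
    have h2 : P y (stayS d 0 ∩ {ω | ω 0 = (y : ℤ)}) = 1 := by
      rw [← mem_ae_iff_prob_eq_one (meas_A d 0 y)]
      filter_upwards [hstart y] with ω h
      refine ⟨fun k hk => ?_, h⟩
      rw [Nat.le_zero.1 hk, h]; exact hmem y
    rw [h2, one_mul] at h1
    rw [← h1]
    exact ne_top_of_le_ne_top (hB3' y (hmem y)) (setLIntegral_le_lintegral _ _)
  set r : Finset.Icc (-d) d → ℝ≥0∞ := fun y => ∑' z : ℤ, (z.natAbs : ℝ≥0∞) * K y z with hrdef
  set C : ℝ≥0∞ := ∑ y, r y with hC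
  have hCtop : C ≠ ⊤ := ENNReal.sum_ne_top.2 fun y _ => hr y
  have hrC : ∀ y, r y ≤ C := fun y => Finset.single_le_sum (f := r) (fun _ _ => zero_le) (Finset.mem_univ y)
  -- stay probabilities tend to zero
  have htend : ∀ y : Finset.Icc (-d) d,
      Tendsto (fun n => P y (stayS d n)) atTop (nhds 0) := by
    intro y
    have h := tendsto_measure_iInter_atTop (μ := P y) (s := stayS d)
      (fun n => (meas_stayS d n).nullMeasurableSet)
      (fun m n hmn ω h k hk => h k (hk.trans hmn)) ⟨0, measure_ne_top _ _⟩
    have h0 : P y (⋂ n, stayS d n) = 0 := by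
      have hc : (⋂ n, stayS d n) = {ω | ∃ k, d < |ω k|}ᶜ := by
        ext ω
        simp only [stayS, Set.mem_iInter, Set.mem_ofPred_eq, Set.mem_compl_iff, not_exists, not_lt]
        exact ⟨fun h k => h k k le_rfl, fun h n k _ => h k⟩
      rw [hc, prob_compl_eq_zero_iff]
      · exact hB2 y (hmem y)
      · have : {ω : ℕ → ℤ | ∃ k, d < |ω k|} = ⋃ k, {ω | ω k ∈ {z : ℤ | d < |z|}} := by
          ext ω; simp
        rw [this]
        exact MeasurableSet.iUnion fun k => meas_coord k _
    rwa [h0] at h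
  obtain ⟨N, hN⟩ : ∃ N, ∀ y : Finset.Icc (-d) d, P y (stayS d N) < 2⁻¹ := by
    have : ∀ᶠ n in atTop, ∀ y : Finset.Icc (-d) d, P y (stayS d n) < 2⁻¹ :=
      eventually_all.2 fun y => (htend y).eventually_lt_const (by simp)
    exact this.exists
  let x' : Finset.Icc (-d) d := ⟨x, Finset.mem_Icc.2 (abs_le.1 hx)⟩
  have hpow : ∀ (y : Finset.Icc (-d) d) (n : ℕ), P y (stayS d n) = ∑ z, (TM d K ^ n) y z := by
    intro y n
    rw [stay_sum]
    exact Finset.sum_congr rfl fun z _ => stay_pow d K (P y) y (hcyl y) n z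
  have hsum : ∑' n, P x (stayS d n) ≠ ⊤ := by
    refine sum_finite _ N (fun n => prob_le_one) fun n => ?_
    have h1 := hpow x' (N + n)
    have h2 := hpow x' n
    change P x _ = _ at h1
    change P x _ = _ at h2
    rw [h1, h2, add_comm N n, pow_add]
    simp only [Matrix.mul_apply]
    rw [Finset.sum_comm, Finset.mul_sum]
    refine Finset.sum_le_sum fun w _ => ?_
    rw [← Finset.mul_sum, ← hpow, mul_comm]
    gcongr
    exact (hN w).le
  -- bound of each piece
  have hpiece : ∀ n, ∫⁻ ω in stayS d n, ((ω (n + 1)).natAbs : ℝ≥0∞) ∂(P x) ≤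
      P x (stayS d n) * C := by
    intro n
    conv_lhs => rw [stay_union d n]
    refine (lintegral_iUnion_le _ _).trans ?_
    rw [tsum_fintype, stay_sum d (P x) n, Finset.sum_mul]
    refine Finset.sum_le_sum fun y _ => ?_
    rw [step_int d K (P x) x (hcyl x)]
    gcongr
    exact hrC y
  have hae : ∀ᵐ ω ∂(P x), ∃ k, d < |ω k| := by
    refine (mem_ae_iff_prob_eq_one ?_).2 (hB2 x hx)
    have : {ω : ℕ → ℤ | ∃ k, d < |ω k|} = ⋃ k, {ω | ω k ∈ {z : ℤ | d < |z|}} := by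
      ext ω; simp
    rw [this]
    exact MeasurableSet.iUnion fun k => meas_coord k _
  have hmain : ∫⁻ ω, ((ω (firstExit d ω)).natAbs : ℝ≥0∞) ∂(P x) ≤
      ∫⁻ ω, ∑' n, (stayS d n).indicator (fun ω => ((ω (n + 1)).natAbs : ℝ≥0∞)) ω ∂(P x) := by
    refine lintegral_mono_ae ?_
    filter_upwards [hae, hstart x] with ω h1 h2
    have h3 : d < |ω (firstExit d ω)| := Nat.sInf_mem (s := {k : ℕ | d < |ω k|}) h1
    obtain ⟨m, hm⟩ : ∃ m, firstExit d ω = m + 1 := by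
      refine Nat.exists_eq_succ_of_ne_zero fun h0 => ?_
      rw [h0, h2] at h3
      omega
    refine le_trans ?_ (ENNReal.le_tsum m)
    have h4 : ω ∈ stayS d m := by
      intro k hk
      have : k ∉ {k : ℕ | d < |ω k|} := Nat.notMem_of_lt_sInf (by
        change k < firstExit d ω
        omega)
      exact not_lt.1 this
    rw [Set.indicator_of_mem h4, hm]
  refine ne_top_of_le_ne_top ?_ hmain
  have hmeas : ∀ n : ℕ, Measurable fun ω : ℕ → ℤ => ((ω (n + 1)).natAbs : ℝ≥0∞) := fun n =>
    (Measurable.of_discrete (f := fun z : ℤ => (z.natAbs : ℝ≥0∞))).comp (measurable_pi_apply (n + 1))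
  rw [lintegral_tsum fun n => ((hmeas n).indicator (meas_stayS d n)).aemeasurable]
  refine ne_top_of_le_ne_top (ENNReal.mul_ne_top hsum hCtop) ?_
  rw [← ENNReal.tsum_mul_right]
  refine ENNReal.tsum_le_tsum fun n => ?_
  rw [lintegral_indicator (meas_stayS d n)]
  exact hpiece n
end
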